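/- Let Ω ⊂ ℝⁿ be a bounded John domain with n ≥ 3, let 1 < p, q < ∞ with 1/p + 1/q = 1, β ≥ 0, and let {Ω_t}_{t∈Γ} be a collection of extended Whitney cubes of Ω. Then there exists a positive constant C₀ (one may take C₀ ≤ C K^{n+1+β} with C independent of Ω, where K is the geometric John constant from the tree structure) such that for every g ∈ W₀ there exists a collection of functions {g_t}_{t∈Γ} satisfying: (1) g = Σ_{t∈Γ} g_t; (2) supp(g_t) ⊂ Ω_t; (3) g_t ∈ W₀ for all t ∈ Γ; (4) Σ_{t∈Γ} ‖g_t‖_{L^q(Ω_t,ρ^{−β})}^q ≤ C₀^q ‖g‖_{L^q(Ω,ρ^{−β})}^q; and (5) g_t ≢ 0 only for finitely many t ∈ Γ. -/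

import Mathlib

open MeasureTheory Metric Set Matrix
open scoped BigOperators ENNReal

noncomputable section

abbrev Euc (n : ℕ) := EuclideanSpace ℝ (Fin n)

/-- Differential matrix `(Dv)_{ij} = ∂v_i/∂x_j` (computed via the Fréchet derivative). -/
def Dmat {n : ℕ} (v : Euc n → Euc n) (x : Euc n) : Matrix (Fin n) (Fin n) ℝ :=
  fun i j => fderiv ℝ v x (EuclideanSpace.single j 1) i

/-- Symmetric part of the differential matrix. -/
def epsMat {n : ℕ} (v : Euc n → Euc n) (x : Euc n) : Matrix (Fin n) (Fin n) ℝ :=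
  (1 / 2 : ℝ) • (Dmat v x + (Dmat v x)ᵀ)

/-- Trace-free part of the symmetric part of the differential matrix. -/
def lMat {n : ℕ} (v : Euc n → Euc n) (x : Euc n) : Matrix (Fin n) (Fin n) ℝ :=
  epsMat v x - (Matrix.trace (Dmat v x) / (n : ℝ)) • (1 : Matrix (Fin n) (Fin n) ℝ)

/-- Frobenius (Euclidean) norm of a matrix. -/
def matNorm {n : ℕ} (M : Matrix (Fin n) (Fin n) ℝ) : ℝ :=
  Real.sqrt (∑ i, ∑ j, (M i j) ^ 2)

/-- `M : N = Σ_{ij} M_{ij} N_{ij}`. -/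
def matDot {n : ℕ} (M N : Matrix (Fin n) (Fin n) ℝ) : ℝ := ∑ i, ∑ j, M i j * N i j

/-- Distance to the boundary of `Ω`. -/
def distBd {n : ℕ} (Ω : Set (Euc n)) (x : Euc n) : ℝ := Metric.infDist x (frontier Ω)

/-- Open axis-parallel cube with center `c` and side length `h`. -/
def openCube {n : ℕ} (c : Euc n) (h : ℝ) : Set (Euc n) := {x | ∀ i, |x i - c i| < h / 2}

/-- Closed axis-parallel cube with center `c` and side length `h`. -/
def closedCube {n : ℕ} (c : Euc n) (h : ℝ) : Set (Euc n) := {x | ∀ i, |x i - c i| ≤ h / 2}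

/-- Bounded John domain: there are `C > 1` and a distinguished point `x₀ ∈ Ω` such that
every point of `Ω` is joined to `x₀` by a rectifiable curve, parameterized by arc length
(hence 1-Lipschitz), along which the distance to the boundary grows linearly. -/
def IsJohnDomain {n : ℕ} (Ω : Set (Euc n)) : Prop :=
  ∃ C > (1 : ℝ), ∃ x₀ ∈ Ω, ∀ y ∈ Ω, ∃ L : ℝ, 0 ≤ L ∧ ∃ γ : ℝ → Euc n,
    γ 0 = y ∧ γ L = x₀ ∧ (∀ t ∈ Icc 0 L, γ t ∈ Ω) ∧
    (∀ s ∈ Icc 0 L, ∀ t ∈ Icc 0 L, dist (γ s) (γ t) ≤ |s - t|) ∧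
    (∀ t ∈ Icc 0 L, t / C ≤ Metric.infDist (γ t) (frontier Ω))

/-- The matrix-valued functions `H_i`. -/
def Hmat {n : ℕ} (i : Fin n) (z : Euc n) : Matrix (Fin n) (Fin n) ℝ :=
  fun j k => if j = k then z i else if k = i then z j else if j = i then -z k else 0

/-- The finite-dimensional space `V = D(Σ)`:
`φ(x) = A + λ I + Σ_i b_i H_i(x − y)` with `A` skew-symmetric. -/
def Vset (n : ℕ) : Set (Euc n → Matrix (Fin n) (Fin n) ℝ) :=
  {φ | ∃ (A : Matrix (Fin n) (Fin n) ℝ) (lam : ℝ) (b : Fin n → ℝ) (y : Euc n),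
    Aᵀ = -A ∧ ∀ x, φ x = A + lam • (1 : Matrix (Fin n) (Fin n) ℝ) + ∑ i, b i • Hmat i (x - y)}


/-- A Whitney decomposition of `Ω`: closed dyadic axis-parallel cubes `Q_t` with pairwise
disjoint interiors covering `Ω`, with `diam(Q_t) ≤ dist(Q_t, ∂Ω) ≤ 4 diam(Q_t)` and
comparable diameters (within a factor 4) for touching cubes. -/
structure WhitneyDecomp (n : ℕ) (Ω : Set (Euc n)) (Γ : Type) where
  c : Γ → Euc n
  s : Γ → ℝ
  s_pos : ∀ t, 0 < s t
  dyadic : ∀ t, ∃ k : ℤ, s t = (2 : ℝ) ^ k ∧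
    ∀ i, ∃ m : ℤ, c t i = (m : ℝ) * (2 : ℝ) ^ k + (2 : ℝ) ^ k / 2
  interior_disj : Pairwise fun t t' =>
    interior (closedCube (c t) (s t)) ∩ interior (closedCube (c t') (s t')) = ∅
  cover : (⋃ t, closedCube (c t) (s t)) = Ω
  diam_le_dist : ∀ t, ∀ x ∈ closedCube (c t) (s t),
    Metric.diam (closedCube (c t) (s t)) ≤ Metric.infDist x (frontier Ω)
  dist_le_diam : ∀ t, ∃ x ∈ closedCube (c t) (s t),
    Metric.infDist x (frontier Ω) ≤ 4 * Metric.diam (closedCube (c t) (s t))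
  nbr_comparable : ∀ t t', (closedCube (c t) (s t) ∩ closedCube (c t') (s t')).Nonempty →
    Metric.diam (closedCube (c t) (s t)) ≤ 4 * Metric.diam (closedCube (c t') (s t'))

/-- The extended (open) Whitney cube `Ω_t = (9/8) Q_t°`. -/
def extCube {n : ℕ} {Ω : Set (Euc n)} {Γ : Type} (wd : WhitneyDecomp n Ω Γ) (t : Γ) :
    Set (Euc n) :=
  openCube (wd.c t) (9 / 8 * wd.s t)

/-- A closed `(n−1)`-dimensional face of the cube with center `c` and side `h`. -/
def cubeFace {n : ℕ} (c : Euc n) (h : ℝ) (i : Fin n) (σ : Bool) : Set (Euc n) :=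
  {x ∈ closedCube c h | x i = c i + (if σ then h / 2 else -(h / 2))}

/-- Two axis-parallel cubes are `(n−1)`-neighbors when their intersection is an
`(n−1)`-dimensional face of one of them. -/
def IsFaceNeighbor {n : ℕ} (c₁ : Euc n) (h₁ : ℝ) (c₂ : Euc n) (h₂ : ℝ) : Prop :=
  ∃ i σ, closedCube c₁ h₁ ∩ closedCube c₂ h₂ = cubeFace c₁ h₁ i σ ∨
    closedCube c₁ h₁ ∩ closedCube c₂ h₂ = cubeFace c₂ h₂ i σ

/-- A tree structure on the index set `Γ` of a Whitney decomposition: a root and a parent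
map reaching the root in finitely many steps, whose edges join `(n−1)`-neighbor cubes. -/
structure TreeStruct {n : ℕ} {Ω : Set (Euc n)} {Γ : Type} (wd : WhitneyDecomp n Ω Γ) where
  root : Γ
  parent : Γ → Γ
  parent_root : parent root = root
  reaches_root : ∀ t, ∃ k : ℕ, parent^[k] t = root
  parent_nbr : ∀ t, t ≠ root →
    IsFaceNeighbor (wd.c t) (wd.s t) (wd.c (parent t)) (wd.s (parent t))

/-- The induced partial order: `s ⪯ t` iff the path from `t` to the root passes
through `s`, i.e. `s` is obtained from `t` by iterating the parent map. -/
def treeLE {n : ℕ} {Ω : Set (Euc n)} {Γ : Type} {wd : WhitneyDecomp n Ω Γ}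
    (T : TreeStruct wd) (s t : Γ) : Prop :=
  ∃ k : ℕ, T.parent^[k] t = s

/-- The shadow `W_t = ⋃_{s ⪰ t} Ω_s` of the extended cube `Ω_t`. -/
def shadow {n : ℕ} {Ω : Set (Euc n)} {Γ : Type} {wd : WhitneyDecomp n Ω Γ}
    (T : TreeStruct wd) (t : Γ) : Set (Euc n) :=
  ⋃ (s : Γ) (_ : treeLE T t s), extCube wd s

open Classical in
/-- The Hardy type operator `Tg(x) = Σ_{t ≠ a} (χ_{B_t}(x)/|W_t|) ∫_{W_t} |g|`, for a
family of cubes `B_t = openCube (Bc t) (Bh t)`. -/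
def hardyT {n : ℕ} {Ω : Set (Euc n)} {Γ : Type} {wd : WhitneyDecomp n Ω Γ}
    (T : TreeStruct wd) (Bc : Γ → Euc n) (Bh : Γ → ℝ) (u : Euc n → ℝ) (x : Euc n) : ℝ :=
  ∑ᶠ t : Γ, if t = T.root then 0 else
    Set.indicator (openCube (Bc t) (Bh t))
      (fun _ => (∫ y in shadow T t, |u y|) / (volume (shadow T t)).toReal) x

/-- Membership in `W ⊆ L^q(Ω, ℝ^{n×n}, ρ^{−β})`: a (weighted-`q`-integrable, hence
integrable) matrix field orthogonal to every element of `V`. -/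
def memW {n : ℕ} (Ω : Set (Euc n)) (q β : ℝ)
    (g : Euc n → Matrix (Fin n) (Fin n) ℝ) : Prop :=
  AEStronglyMeasurable g (volume.restrict Ω) ∧
  IntegrableOn (fun x => matNorm (g x)) Ω ∧
  IntegrableOn (fun x => matNorm (g x) ^ q * distBd Ω x ^ (-(q * β))) Ω ∧
  ∀ φ ∈ Vset n, ∫ x in Ω, matDot (g x) (φ x) = 0

/-- Membership in `W₀`: elements of `W` whose support meets only finitely many of the
extended Whitney cubes. -/
def memW0 {n : ℕ} {Ω : Set (Euc n)} {Γ : Type} (q β : ℝ) (wd : WhitneyDecomp n Ω Γ)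
    (g : Euc n → Matrix (Fin n) (Fin n) ℝ) : Prop :=
  memW Ω q β g ∧ {t : Γ | (Function.support g ∩ extCube wd t).Nonempty}.Finite

section MatrixNorm

variable {n : ℕ}

/-- A square matrix, viewed as a vector of the Euclidean space of its entries. -/
def matVec (M : Matrix (Fin n) (Fin n) ℝ) : EuclideanSpace ℝ (Fin n × Fin n) :=
  WithLp.toLp 2 fun p => M p.1 p.2

lemma matVec_add (M N : Matrix (Fin n) (Fin n) ℝ) : matVec (M + N) = matVec M + matVec N := rfl

lemma matVec_sub (M N : Matrix (Fin n) (Fin n) ℝ) : matVec (M - N) = matVec M - matVec N := rfl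

lemma matVec_smul (a : ℝ) (M : Matrix (Fin n) (Fin n) ℝ) : matVec (a • M) = a • matVec M := rfl

lemma matVec_zero : matVec (0 : Matrix (Fin n) (Fin n) ℝ) = 0 := rfl

lemma continuous_matVec : Continuous (matVec : Matrix (Fin n) (Fin n) ℝ → _) := by
  refine (PiLp.continuous_toLp 2 _).comp (continuous_pi fun p => ?_)
  exact continuous_id.matrix_elem p.1 p.2

lemma matNorm_eq (M : Matrix (Fin n) (Fin n) ℝ) : matNorm M = ‖matVec M‖ := by
  simp [matNorm, matVec, EuclideanSpace.norm_eq, Fintype.sum_prod_type]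

lemma matDot_eq (M N : Matrix (Fin n) (Fin n) ℝ) :
    matDot M N = inner ℝ (matVec M) (matVec N) := by
  simp [matDot, matVec, PiLp.inner_apply, Fintype.sum_prod_type, mul_comm]

lemma matNorm_nonneg (M : Matrix (Fin n) (Fin n) ℝ) : 0 ≤ matNorm M := Real.sqrt_nonneg _

@[simp] lemma matNorm_zero : matNorm (0 : Matrix (Fin n) (Fin n) ℝ) = 0 := by
  simp [matNorm_eq, matVec_zero]

lemma matNorm_add_le (M N : Matrix (Fin n) (Fin n) ℝ) :
    matNorm (M + N) ≤ matNorm M + matNorm N := by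
  simp only [matNorm_eq, matVec_add]; exact norm_add_le _ _

lemma matNorm_sub_le (M N : Matrix (Fin n) (Fin n) ℝ) :
    matNorm (M - N) ≤ matNorm M + matNorm N := by
  simp only [matNorm_eq, matVec_sub]; exact norm_sub_le _ _

lemma matNorm_smul (a : ℝ) (M : Matrix (Fin n) (Fin n) ℝ) :
    matNorm (a • M) = |a| * matNorm M := by
  simp [matNorm_eq, matVec_smul, norm_smul]

lemma matNorm_sum_le {ι : Type*} (s : Finset ι) (M : ι → Matrix (Fin n) (Fin n) ℝ) :
    matNorm (∑ i ∈ s, M i) ≤ ∑ i ∈ s, matNorm (M i) :=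
  Finset.le_sum_of_subadditive _ matNorm_zero.le matNorm_add_le s M

lemma abs_matDot_le (M N : Matrix (Fin n) (Fin n) ℝ) :
    |matDot M N| ≤ matNorm M * matNorm N := by
  simp only [matNorm_eq, matDot_eq]; exact abs_real_inner_le_norm _ _

lemma continuous_matNorm : Continuous (matNorm : Matrix (Fin n) (Fin n) ℝ → ℝ) := by
  simp only [funext matNorm_eq]; exact continuous_matVec.norm

lemma matDot_self (M : Matrix (Fin n) (Fin n) ℝ) : matDot M M = matNorm M ^ 2 := by
  simp [matNorm_eq, matDot_eq]

lemma matNorm_eq_zero {M : Matrix (Fin n) (Fin n) ℝ} : matNorm M = 0 ↔ M = 0 := by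
  rw [matNorm_eq, norm_eq_zero]
  refine ⟨fun h => ?_, fun h => by rw [h, matVec_zero]⟩
  ext i j
  exact congrArg (fun v : EuclideanSpace ℝ (Fin n × Fin n) => v (i, j)) h

lemma matDot_add_left (M N P : Matrix (Fin n) (Fin n) ℝ) :
    matDot (M + N) P = matDot M P + matDot N P := by
  simp only [matDot_eq, matVec_add, inner_add_left]

lemma matDot_sub_left (M N P : Matrix (Fin n) (Fin n) ℝ) :
    matDot (M - N) P = matDot M P - matDot N P := by
  simp only [matDot_eq, matVec_sub, inner_sub_left]

lemma matDot_add_right (M N P : Matrix (Fin n) (Fin n) ℝ) :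
    matDot M (N + P) = matDot M N + matDot M P := by
  simp only [matDot_eq, matVec_add, inner_add_right]

lemma matDot_smul_left (a : ℝ) (M N : Matrix (Fin n) (Fin n) ℝ) :
    matDot (a • M) N = a * matDot M N := by
  simp only [matDot_eq, matVec_smul, real_inner_smul_left]

lemma matDot_smul_right (a : ℝ) (M N : Matrix (Fin n) (Fin n) ℝ) :
    matDot M (a • N) = a * matDot M N := by
  simp only [matDot_eq, matVec_smul, real_inner_smul_right]

@[simp] lemma matDot_zero_left (N : Matrix (Fin n) (Fin n) ℝ) : matDot 0 N = 0 := by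
  simp [matDot]

@[simp] lemma matDot_zero_right (M : Matrix (Fin n) (Fin n) ℝ) : matDot M 0 = 0 := by
  simp [matDot]

lemma matDot_sum_left {ι : Type*} (s : Finset ι) (M : ι → Matrix (Fin n) (Fin n) ℝ)
    (N : Matrix (Fin n) (Fin n) ℝ) : matDot (∑ i ∈ s, M i) N = ∑ i ∈ s, matDot (M i) N := by
  induction s using Finset.cons_induction with
  | empty => simp
  | cons a s ha ih => simp [matDot_add_left, ih]

lemma matDot_sum_right {ι : Type*} (s : Finset ι) (M : Matrix (Fin n) (Fin n) ℝ)
    (N : ι → Matrix (Fin n) (Fin n) ℝ) : matDot M (∑ i ∈ s, N i) = ∑ i ∈ s, matDot M (N i) := by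
  induction s using Finset.cons_induction with
  | empty => simp
  | cons a s ha ih => simp [matDot_add_right, ih]

lemma continuous_matDot :
    Continuous fun P : Matrix (Fin n) (Fin n) ℝ × Matrix (Fin n) (Fin n) ℝ =>
      matDot P.1 P.2 := by
  simp only [matDot_eq]
  exact (continuous_matVec.comp continuous_fst).inner (continuous_matVec.comp continuous_snd)

end MatrixNorm

section Cubes

variable {n : ℕ}

lemma isOpen_openCube (c : Euc n) (h : ℝ) : IsOpen (openCube c h) := by
  simp only [openCube, ofPred_forall]
  refine isOpen_iInter_of_finite fun i => isOpen_lt ?_ continuous_const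
  fun_prop

lemma isClosed_closedCube (c : Euc n) (h : ℝ) : IsClosed (closedCube c h) := by
  simp only [closedCube, ofPred_forall]
  refine isClosed_iInter fun i => isClosed_le ?_ continuous_const
  fun_prop

lemma openCube_subset_closedCube (c : Euc n) (h : ℝ) : openCube c h ⊆ closedCube c h :=
  fun _ hx i => (hx i).le

lemma center_mem_openCube (c : Euc n) {h : ℝ} (hh : 0 < h) : c ∈ openCube c h :=
  fun i => by simpa using hh

lemma volume_openCube (c : Euc n) {h : ℝ} (hh : 0 ≤ h) :
    volume (openCube c h) = ENNReal.ofReal (h ^ n) := by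
  have hset : openCube c h = (MeasurableEquiv.toLp 2 (Fin n → ℝ)).symm ⁻¹'
      (univ.pi fun i => Ioo (c i - h / 2) (c i + h / 2)) := by
    ext x
    simp only [openCube, mem_ofPred_eq, mem_preimage, mem_univ_pi, mem_Ioo, abs_lt]
    refine forall_congr' fun i => ?_
    change _ ↔ c i - h / 2 < x i ∧ x i < c i + h / 2
    constructor <;> rintro ⟨h1, h2⟩ <;> constructor <;> linarith
  rw [hset, (EuclideanSpace.volume_preserving_symm_measurableEquiv_toLp (Fin n)).measure_preimage
    (MeasurableSet.univ_pi fun i => measurableSet_Ioo).nullMeasurableSet, Real.volume_pi_Ioo]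
  rw [Finset.prod_congr rfl (g := fun _ => ENNReal.ofReal h) (fun i _ => by ring_nf)]
  simp [ENNReal.ofReal_pow hh]

lemma dist_le_of_coord_le {x y : Euc n} {r : ℝ} (hr : 0 ≤ r) (h : ∀ i, |x i - y i| ≤ r) :
    dist x y ≤ √n * r := by
  rw [EuclideanSpace.dist_eq]
  calc √(∑ i, dist (x i) (y i) ^ 2) ≤ √(∑ _i : Fin n, r ^ 2) := by
        refine Real.sqrt_le_sqrt (Finset.sum_le_sum fun i _ => ?_)
        rw [Real.dist_eq]
        exact pow_le_pow_left₀ (abs_nonneg _) (h i) 2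
    _ = √n * r := by
        rw [Finset.sum_const, Finset.card_univ, Fintype.card_fin, nsmul_eq_mul,
          Real.sqrt_mul (by positivity), Real.sqrt_sq hr]

lemma dist_le_of_mem_closedCube {c x y : Euc n} {h : ℝ} (hh : 0 ≤ h) (hx : x ∈ closedCube c h)
    (hy : y ∈ closedCube c h) : dist x y ≤ √n * h := by
  refine dist_le_of_coord_le hh fun i => ?_
  have h1 := abs_le.1 (hx i)
  have h2 := abs_le.1 (hy i)
  rw [abs_le]; constructor <;> linarith [h1.1, h1.2, h2.1, h2.2]

lemma isBounded_closedCube (c : Euc n) {h : ℝ} (hh : 0 ≤ h) :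
    Bornology.IsBounded (closedCube c h) :=
  Metric.isBounded_iff.2 ⟨√n * h, fun _ hx _ hy => dist_le_of_mem_closedCube hh hx hy⟩

lemma diam_closedCube (c : Euc n) {h : ℝ} (hh : 0 ≤ h) :
    Metric.diam (closedCube c h) = √n * h := by
  apply le_antisymm
  · exact Metric.diam_le_of_forall_dist_le (by positivity)
      fun x hx y hy => dist_le_of_mem_closedCube hh hx hy
  · set v : Euc n := WithLp.toLp 2 fun _ => h / 2
    have hv : ∀ i, v i = h / 2 := fun i => rfl
    have h1 : c + v ∈ closedCube c h := fun i => by simp [hv, abs_of_nonneg (div_nonneg hh two_pos.le)]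
    have h2 : c - v ∈ closedCube c h := fun i => by simp [hv, abs_of_nonneg (div_nonneg hh two_pos.le)]
    refine le_trans (le_of_eq ?_) (Metric.dist_le_diam_of_mem (isBounded_closedCube c hh) h1 h2)
    rw [EuclideanSpace.dist_eq]
    have : ∀ i, dist ((c + v) i) ((c - v) i) = h := fun i => by
      rw [Real.dist_eq, PiLp.add_apply, PiLp.sub_apply, hv, abs_of_nonneg] <;> linarith
    simp only [this, Finset.sum_const, Finset.card_univ, Fintype.card_fin, nsmul_eq_mul]
    rw [Real.sqrt_mul (by positivity), Real.sqrt_sq hh]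

lemma measurableSet_openCube (c : Euc n) (h : ℝ) : MeasurableSet (openCube c h) :=
  (isOpen_openCube c h).measurableSet

lemma volume_openCube_lt_top (c : Euc n) {h : ℝ} (hh : 0 ≤ h) : volume (openCube c h) < ⊤ := by
  rw [volume_openCube c hh]; exact ENNReal.ofReal_lt_top

lemma volume_closedCube (c : Euc n) {h : ℝ} (hh : 0 ≤ h) :
    volume (closedCube c h) = ENNReal.ofReal (h ^ n) := by
  have hset : closedCube c h = (MeasurableEquiv.toLp 2 (Fin n → ℝ)).symm ⁻¹'
      (univ.pi fun i => Icc (c i - h / 2) (c i + h / 2)) := by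
    ext x
    simp only [closedCube, mem_ofPred_eq, mem_preimage, mem_univ_pi, mem_Icc, abs_le]
    refine forall_congr' fun i => ?_
    change _ ↔ c i - h / 2 ≤ x i ∧ x i ≤ c i + h / 2
    constructor <;> rintro ⟨h1, h2⟩ <;> constructor <;> linarith
  rw [hset, (EuclideanSpace.volume_preserving_symm_measurableEquiv_toLp (Fin n)).measure_preimage
    (MeasurableSet.univ_pi fun i => measurableSet_Icc).nullMeasurableSet, volume_pi_pi]
  simp only [Real.volume_Icc]
  rw [Finset.prod_congr rfl (g := fun _ => ENNReal.ofReal h) (fun i _ => by ring_nf)]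
  simp [ENNReal.ofReal_pow hh]

end Cubes

section Whitney

variable {n : ℕ} {Ω : Set (Euc n)} {Γ : Type}

lemma one_le_sqrt_natCast (hn : 0 < n) : 1 ≤ √(n : ℝ) :=
  Real.one_le_sqrt.2 (by exact_mod_cast hn)

lemma center_mem_closedCube (wd : WhitneyDecomp n Ω Γ) (t : Γ) :
    wd.c t ∈ closedCube (wd.c t) (wd.s t) :=
  openCube_subset_closedCube _ _ (center_mem_openCube _ (wd.s_pos t))

lemma closedCube_subset_domain (wd : WhitneyDecomp n Ω Γ) (t : Γ) :
    closedCube (wd.c t) (wd.s t) ⊆ Ω :=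
  (subset_iUnion (fun t => closedCube (wd.c t) (wd.s t)) t).trans wd.cover.subset

lemma closedCube_subset_extCube (wd : WhitneyDecomp n Ω Γ) (t : Γ) :
    closedCube (wd.c t) (wd.s t) ⊆ extCube wd t := fun x hx i => by
  have := hx i
  have := wd.s_pos t
  linarith

lemma distBd_ge_of_mem_closedCube (wd : WhitneyDecomp n Ω Γ) {t : Γ} {x : Euc n}
    (hx : x ∈ closedCube (wd.c t) (wd.s t)) : √n * wd.s t ≤ distBd Ω x := by
  rw [← diam_closedCube (wd.c t) (wd.s_pos t).le]; exact wd.diam_le_dist t x hx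

lemma distBd_le_add_dist (x y : Euc n) : distBd Ω x ≤ distBd Ω y + dist x y :=
  Metric.infDist_le_infDist_add_dist

lemma distBd_le_of_mem_closedCube (wd : WhitneyDecomp n Ω Γ) {t : Γ} {x : Euc n}
    (hx : x ∈ closedCube (wd.c t) (wd.s t)) : distBd Ω x ≤ 5 * √n * wd.s t := by
  obtain ⟨y, hy, hle⟩ := wd.dist_le_diam t
  rw [diam_closedCube (wd.c t) (wd.s_pos t).le] at hle
  have h1 := dist_le_of_mem_closedCube (wd.s_pos t).le hx hy
  have h2 := distBd_le_add_dist (Ω := Ω) x y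
  change distBd Ω y ≤ _ at hle
  linarith

lemma exists_mem_closedCube_dist_le (wd : WhitneyDecomp n Ω Γ) {t : Γ} {x : Euc n}
    (hx : x ∈ extCube wd t) :
    ∃ y ∈ closedCube (wd.c t) (wd.s t), dist x y ≤ √n * (wd.s t / 16) := by
  have hs := wd.s_pos t
  refine ⟨WithLp.toLp 2 fun i =>
    max (wd.c t i - wd.s t / 2) (min (wd.c t i + wd.s t / 2) (x i)), fun i => ?_,
    dist_le_of_coord_le (by positivity) fun i => ?_⟩
  · change |max _ _ - _| ≤ _
    rw [abs_le]
    constructor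
    · linarith [le_max_left (wd.c t i - wd.s t / 2) (min (wd.c t i + wd.s t / 2) (x i))]
    · have : max (wd.c t i - wd.s t / 2) (min (wd.c t i + wd.s t / 2) (x i)) ≤
          wd.c t i + wd.s t / 2 := max_le (by linarith) (min_le_left _ _)
      linarith
  · change |_ - max _ _| ≤ _
    have h := abs_lt.1 (hx i)
    rcases max_cases (wd.c t i - wd.s t / 2) (min (wd.c t i + wd.s t / 2) (x i)) with h1 | h1 <;>
    rcases min_cases (wd.c t i + wd.s t / 2) (x i) with h2 | h2 <;>
    rw [h1.1] <;> try rw [h2.1]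
    all_goals rw [abs_le]; constructor <;> linarith [h.1, h.2, h1.2, h2.2]

lemma distBd_ge_of_mem_extCube (hn : 0 < n) (wd : WhitneyDecomp n Ω Γ) {t : Γ} {x : Euc n}
    (hx : x ∈ extCube wd t) : wd.s t / 2 ≤ distBd Ω x := by
  obtain ⟨y, hy, hxy⟩ := exists_mem_closedCube_dist_le wd hx
  have h1 := distBd_ge_of_mem_closedCube wd hy
  have h2 := distBd_le_add_dist (Ω := Ω) y x
  rw [dist_comm] at h2
  nlinarith [one_le_sqrt_natCast hn, wd.s_pos t]

lemma distBd_le_of_mem_extCube (wd : WhitneyDecomp n Ω Γ) {t : Γ} {x : Euc n}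
    (hx : x ∈ extCube wd t) : distBd Ω x ≤ 6 * √n * wd.s t := by
  obtain ⟨y, hy, hxy⟩ := exists_mem_closedCube_dist_le wd hx
  have h1 := distBd_le_of_mem_closedCube wd hy
  have h2 := distBd_le_add_dist (Ω := Ω) x y
  nlinarith [Real.sqrt_nonneg (n : ℝ), wd.s_pos t, mul_nonneg (Real.sqrt_nonneg (n : ℝ)) (wd.s_pos t).le]

lemma dist_center_le_of_mem_extCube (wd : WhitneyDecomp n Ω Γ) {t : Γ} {x : Euc n}
    (hx : x ∈ extCube wd t) : dist x (wd.c t) ≤ √n * wd.s t :=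
  dist_le_of_coord_le (wd.s_pos t).le fun i => by
    have := hx i
    have := wd.s_pos t
    linarith

lemma extCube_subset_domain (hn : 0 < n) (hΩo : IsOpen Ω) (wd : WhitneyDecomp n Ω Γ) (t : Γ) :
    extCube wd t ⊆ Ω := by
  intro x hx
  obtain ⟨y, hy, hxy⟩ := exists_mem_closedCube_dist_le wd hx
  have h1 := distBd_ge_of_mem_closedCube wd hy
  have hyΩ := closedCube_subset_domain wd t hy
  have hs := wd.s_pos t
  have hn' := one_le_sqrt_natCast hn
  have hlt : dist x y < distBd Ω y := by nlinarith
  have hpre : IsPreconnected (ball y (distBd Ω y)) := (convex_ball _ _).isPreconnected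
  refine hpre.subset_of_closure_inter_subset hΩo
    ⟨y, mem_ball_self (lt_of_le_of_lt dist_nonneg hlt), hyΩ⟩ ?_ (mem_ball.2 hlt)
  rintro z ⟨hz, hzb⟩
  by_contra hzΩ
  have hzf : z ∈ frontier Ω := by rw [hΩo.frontier_eq]; exact ⟨hz, hzΩ⟩
  have := Metric.infDist_le_dist_of_mem (x := y) hzf
  rw [mem_ball, dist_comm] at hzb
  exact absurd hzb (not_lt.2 this)

lemma openCube_disjoint (wd : WhitneyDecomp n Ω Γ) {t t' : Γ} (h : t ≠ t') :
    Disjoint (openCube (wd.c t) (wd.s t)) (openCube (wd.c t') (wd.s t')) := by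
  have := wd.interior_disj h
  rw [disjoint_iff_inter_eq_empty, ← subset_empty_iff]
  refine this ▸ inter_subset_inter ?_ ?_ <;>
  exact interior_maximal (openCube_subset_closedCube _ _) (isOpen_openCube _ _)

lemma countable_index (wd : WhitneyDecomp n Ω Γ) : Countable Γ := by
  rw [← Set.countable_univ_iff]
  refine Set.PairwiseDisjoint.countable_of_isOpen
    (s := fun t => openCube (wd.c t) (wd.s t)) (fun t _ t' _ h => openCube_disjoint wd h)
    (fun t _ => isOpen_openCube _ _) fun t _ => ⟨_, center_mem_openCube _ (wd.s_pos t)⟩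

lemma sum_side_pow_le (wd : WhitneyDecomp n Ω Γ) (I : Finset Γ) {X : Set (Euc n)}
    (hX : volume X ≠ ⊤) (h : ∀ t ∈ I, openCube (wd.c t) (wd.s t) ⊆ X) :
    ∑ t ∈ I, wd.s t ^ n ≤ (volume X).toReal := by
  have h1 : ∑ t ∈ I, volume (openCube (wd.c t) (wd.s t)) ≤ volume X := by
    rw [← measure_biUnion_finset (fun t _ t' _ h => openCube_disjoint wd h)
      fun t _ => measurableSet_openCube _ _]
    exact measure_mono (iUnion₂_subset h)
  rw [Finset.sum_congr rfl fun t _ => volume_openCube (wd.c t) (wd.s_pos t).le,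
    ← ENNReal.ofReal_sum_of_nonneg fun t _ => pow_nonneg (wd.s_pos t).le n] at h1
  exact (ENNReal.ofReal_le_iff_le_toReal hX).1 h1

lemma finite_side_ge (wd : WhitneyDecomp n Ω Γ) (hΩb : Bornology.IsBounded Ω) {δ : ℝ}
    (hδ : 0 < δ) : {t : Γ | δ ≤ wd.s t}.Finite := by
  by_contra hinf
  set V := (volume Ω).toReal
  obtain ⟨N, hN⟩ := exists_nat_gt (V / δ ^ n)
  obtain ⟨I, hI, hcard⟩ := Set.Infinite.exists_subset_card_eq hinf N
  have h1 := sum_side_pow_le wd I hΩb.measure_lt_top.ne fun t _ =>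
    (openCube_subset_closedCube _ _).trans (closedCube_subset_domain wd t)
  have h2 : ∑ t ∈ I, δ ^ n ≤ ∑ t ∈ I, wd.s t ^ n :=
    Finset.sum_le_sum fun t ht => pow_le_pow_left₀ hδ.le (hI ht) n
  rw [Finset.sum_const, hcard, nsmul_eq_mul] at h2
  rw [div_lt_iff₀ (pow_pos hδ n)] at hN
  linarith

lemma side_le_of_inter (hn : 0 < n) (wd : WhitneyDecomp n Ω Γ) {t t' : Γ}
    (h : (closedCube (wd.c t) (wd.s t) ∩ closedCube (wd.c t') (wd.s t')).Nonempty) :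
    wd.s t ≤ 4 * wd.s t' := by
  have := wd.nbr_comparable t t' h
  rw [diam_closedCube _ (wd.s_pos t).le, diam_closedCube _ (wd.s_pos t').le] at this
  have hn' := one_le_sqrt_natCast hn
  have : √n * wd.s t ≤ √n * (4 * wd.s t') := by linarith
  exact le_of_mul_le_mul_left this (by linarith)

lemma openCube_subset_extCube (wd : WhitneyDecomp n Ω Γ) {t : Γ} {x : Euc n} {h : ℝ}
    (hx : x ∈ closedCube (wd.c t) (wd.s t)) (hh : h ≤ wd.s t / 8) :
    openCube x h ⊆ extCube wd t := fun z hz i => by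
  have h1 := hz i
  have h2 := hx i
  have h3 := abs_sub_le (z i) (x i) (wd.c t i)
  linarith

lemma finite_inter_extCube (hn : 0 < n) (wd : WhitneyDecomp n Ω Γ)
    (hΩb : Bornology.IsBounded Ω) (t : Γ) :
    {t' : Γ | (extCube wd t ∩ extCube wd t').Nonempty}.Finite := by
  have hn' := one_le_sqrt_natCast hn
  refine (finite_side_ge wd hΩb (δ := wd.s t / (12 * √n))
    (div_pos (wd.s_pos t) (by positivity))).subset ?_
  rintro t' ⟨x, hx, hx'⟩
  have h1 := distBd_ge_of_mem_extCube hn wd hx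
  have h2 := distBd_le_of_mem_extCube wd hx'
  rw [mem_ofPred_eq, div_le_iff₀ (by positivity)]
  linarith

end Whitney

section JohnChains

variable {n : ℕ} {Ω : Set (Euc n)} {Γ : Type}

lemma integrable_shifted_kernel (y : Euc n) {l : ℝ} (hl : 0 < l) :
    Integrable (fun x : Euc n => (l + dist x y) ^ (-((n : ℝ) + 1))) ∧
    ∫ x : Euc n, (l + dist x y) ^ (-((n : ℝ) + 1)) =
      (∫ x : Euc n, (1 + ‖x‖) ^ (-((n : ℝ) + 1))) / l := by
  set F : Euc n → ℝ := fun x => (1 + ‖x‖) ^ (-((n : ℝ) + 1))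
  have hF : Integrable F := integrable_one_add_norm (by simp)
  have hfun : (fun x : Euc n => (l + dist x y) ^ (-((n : ℝ) + 1))) =
      fun x => l ^ (-((n : ℝ) + 1)) * F (l⁻¹ • (x - y)) := by
    funext x
    have h0 : 0 ≤ ‖l⁻¹ • (x - y)‖ := norm_nonneg _
    simp only [F]
    rw [← Real.mul_rpow hl.le (by linarith), norm_smul, Real.norm_of_nonneg (inv_nonneg.2 hl.le),
      dist_eq_norm, mul_add, mul_one, mul_inv_cancel_left₀ hl.ne']
  rw [hfun]
  constructor
  · exact ((hF.comp_smul (inv_ne_zero hl.ne')).comp_sub_right y).const_mul _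
  · rw [integral_const_mul, integral_sub_right_eq_self (fun x => F (l⁻¹ • x)) y,
      Measure.integral_comp_smul]
    simp only [finrank_euclideanSpace, Fintype.card_fin, inv_pow, inv_inv, smul_eq_mul]
    rw [abs_of_nonneg (by positivity), neg_add, Real.rpow_add hl, Real.rpow_neg hl.le,
      Real.rpow_natCast, Real.rpow_neg_one]
    have : l ^ n ≠ 0 := pow_ne_zero _ hl.ne'
    field_simp

lemma sum_inv_side_le (wd : WhitneyDecomp n Ω Γ) (I : Finset Γ) (y : Euc n) {l A : ℝ}
    (hl : 0 < l) (hA : 0 < A)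
    (h : ∀ t ∈ I, ∀ x ∈ openCube (wd.c t) (wd.s t), l + dist x y ≤ A * wd.s t) :
    ∑ t ∈ I, (wd.s t)⁻¹ ≤
      A ^ ((n : ℝ) + 1) * (∫ x : Euc n, (1 + ‖x‖) ^ (-((n : ℝ) + 1))) / l := by
  obtain ⟨hint, hval⟩ := integrable_shifted_kernel y hl
  set w : Euc n → ℝ := fun x => (l + dist x y) ^ (-((n : ℝ) + 1))
  have hw : ∀ x, 0 ≤ w x := fun x =>
    Real.rpow_nonneg (add_nonneg hl.le dist_nonneg) _
  have hcube : ∀ t ∈ I, (wd.s t)⁻¹ ≤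
      A ^ ((n : ℝ) + 1) * ∫ x in openCube (wd.c t) (wd.s t), w x := by
    intro t ht
    have hs := wd.s_pos t
    have h1 : ∫ _x in openCube (wd.c t) (wd.s t), (A * wd.s t) ^ (-((n : ℝ) + 1)) ≤
        ∫ x in openCube (wd.c t) (wd.s t), w x := by
      refine setIntegral_mono_on ?_ hint.integrableOn (measurableSet_openCube _ _) fun x hx => ?_
      · exact integrableOn_const (volume_openCube_lt_top _ hs.le).ne
      · exact Real.rpow_le_rpow_of_nonpos (add_pos_of_pos_of_nonneg hl dist_nonneg) (h t ht x hx)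
          (by linarith [(Nat.cast_nonneg n : (0 : ℝ) ≤ n)])
    refine le_trans (le_of_eq ?_) (mul_le_mul_of_nonneg_left h1 (Real.rpow_nonneg hA.le _))
    rw [setIntegral_const, measureReal_def, volume_openCube _ hs.le,
      ENNReal.toReal_ofReal (by positivity), smul_eq_mul, Real.mul_rpow hA.le hs.le,
      Real.rpow_neg hA.le, neg_add, Real.rpow_add hs, Real.rpow_neg hs.le, Real.rpow_natCast,
      Real.rpow_neg_one]
    have h2 : A ^ ((n : ℝ) + 1) ≠ 0 := (Real.rpow_pos_of_pos hA _).ne'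
    have h3 : wd.s t ^ n ≠ 0 := pow_ne_zero _ hs.ne'
    field_simp
  calc ∑ t ∈ I, (wd.s t)⁻¹
      ≤ ∑ t ∈ I, A ^ ((n : ℝ) + 1) * ∫ x in openCube (wd.c t) (wd.s t), w x :=
        Finset.sum_le_sum hcube
    _ = A ^ ((n : ℝ) + 1) * ∫ x in ⋃ t ∈ I, openCube (wd.c t) (wd.s t), w x := by
        rw [← Finset.mul_sum, integral_biUnion_finset I
          (fun t _ => measurableSet_openCube _ _) (fun t _ t' _ h => openCube_disjoint wd h)
          fun t _ => hint.integrableOn]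
    _ ≤ A ^ ((n : ℝ) + 1) * ∫ x, w x :=
        mul_le_mul_of_nonneg_left
          (setIntegral_le_integral hint (Filter.Eventually.of_forall hw))
          (Real.rpow_nonneg hA.le _)
    _ = _ := by rw [hval, mul_div_assoc]

/-- The graph on the Whitney cubes whose edges join touching cubes. -/
def whitneyGraph (wd : WhitneyDecomp n Ω Γ) : SimpleGraph Γ where
  Adj t t' := t ≠ t' ∧ (closedCube (wd.c t) (wd.s t) ∩ closedCube (wd.c t') (wd.s t')).Nonempty
  symm := ⟨fun t t' h => ⟨h.1.symm, by rw [inter_comm]; exact h.2⟩⟩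
  loopless := ⟨fun t h => h.1 rfl⟩

lemma exists_walk_of_isPreconnected (wd : WhitneyDecomp n Ω Γ) {S : Set (Euc n)}
    (hS : IsPreconnected S) (hSΩ : S ⊆ Ω) {H : Set Γ} (hH : H.Finite)
    (hmem : ∀ t, (S ∩ closedCube (wd.c t) (wd.s t)).Nonempty → t ∈ H) {a b : Γ}
    (ha : (S ∩ closedCube (wd.c a) (wd.s a)).Nonempty)
    (hb : (S ∩ closedCube (wd.c b) (wd.s b)).Nonempty) :
    ∃ w : (whitneyGraph wd).Walk a b, ∀ u ∈ w.support, u ∈ H := by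
  let A : Set Γ := {t | ∃ w : (whitneyGraph wd).Walk a t, ∀ u ∈ w.support, u ∈ H}
  by_contra hbA
  have hAH : A ⊆ H := fun t ⟨w, hw⟩ => hw t w.end_mem_support
  have haA : a ∈ A := ⟨.nil, by simpa using hmem a ha⟩
  have hcl : ∀ B ⊆ H, IsClosed (⋃ t ∈ B, closedCube (wd.c t) (wd.s t)) := fun B hB =>
    (hH.subset hB).isClosed_biUnion fun t _ => isClosed_closedCube _ _
  have hcov : S ⊆ (⋃ t ∈ A, closedCube (wd.c t) (wd.s t)) ∪
      ⋃ t ∈ H \ A, closedCube (wd.c t) (wd.s t) := by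
    intro x hx
    obtain ⟨t, ht⟩ := mem_iUnion.1 (wd.cover.symm.subset (hSΩ hx))
    have htH := hmem t ⟨x, hx, ht⟩
    by_cases htA : t ∈ A
    · exact Or.inl (mem_biUnion htA ht)
    · exact Or.inr (mem_biUnion (⟨htH, htA⟩ : t ∈ H \ A) ht)
  obtain ⟨za, hza, hza'⟩ := ha
  obtain ⟨zb, hzb, hzb'⟩ := hb
  obtain ⟨z, hzS, hz1, hz2⟩ := isPreconnected_closed_iff.1 hS _ _ (hcl A hAH)
    (hcl (H \ A) sdiff_subset) hcov ⟨za, hza, mem_biUnion haA hza'⟩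
    ⟨zb, hzb, mem_biUnion (⟨hmem b ⟨zb, hzb, hzb'⟩, hbA⟩ : b ∈ H \ A) hzb'⟩
  simp only [mem_iUnion] at hz1 hz2
  obtain ⟨t, ⟨w, hw⟩, hzt⟩ := hz1
  obtain ⟨t', ht', hzt'⟩ := hz2
  refine ht'.2 ?_
  have hne : t ≠ t' := by
    rintro rfl; exact ht'.2 ⟨w, hw⟩
  refine ⟨w.concat (show (whitneyGraph wd).Adj t t' from ⟨hne, z, hzt, hzt'⟩), fun u hu => ?_⟩
  rw [SimpleGraph.Walk.support_concat, List.mem_append, List.mem_singleton] at hu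
  rcases hu with hu | rfl
  exacts [hw u hu, ht'.1]

/-- In a John domain every Whitney cube is joined to a fixed one by a chain of touching cubes
whose inverse side lengths have a sum controlled by the inverse of the initial side length. -/
lemma exists_root_and_chains (hn : 0 < n) (hΩb : Bornology.IsBounded Ω) (hJ : IsJohnDomain Ω)
    (wd : WhitneyDecomp n Ω Γ) :
    ∃ root : Γ, ∃ M : ℝ, ∀ s, ∃ w : (whitneyGraph wd).Walk s root,
      (w.support.map fun t => (wd.s t)⁻¹).sum ≤ M / wd.s s := by
  classical
  obtain ⟨C, hC, x₀, hx₀, hJ⟩ := hJ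
  have hn' := one_le_sqrt_natCast hn
  obtain ⟨root, hroot⟩ := mem_iUnion.1 (wd.cover.symm.subset hx₀)
  have hroot' : x₀ ∈ closedCube (wd.c root) (wd.s root) := hroot
  set A := √n * (6 + 10 * C)
  have hA : 0 < A := by positivity
  refine ⟨root, A ^ ((n : ℝ) + 1) * ∫ x : Euc n, (1 + ‖x‖) ^ (-((n : ℝ) + 1)), fun s => ?_⟩
  have hs := wd.s_pos s
  obtain ⟨L, hL, γ, hγ0, hγL, hγΩ, hγd, hγJ⟩ :=
    hJ _ (closedCube_subset_domain wd s (center_mem_closedCube wd s))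
  have hcont : ContinuousOn γ (Icc 0 L) := by
    refine LipschitzOnWith.continuousOn (K := 1) (LipschitzOnWith.of_dist_le_mul fun a ha b hb => ?_)
    simpa [Real.dist_eq] using hγd a ha b hb
  have hpre : IsPreconnected (γ '' Icc 0 L) := isPreconnected_Icc.image γ hcont
  set H : Set Γ := {t | ((γ '' Icc 0 L) ∩ closedCube (wd.c t) (wd.s t)).Nonempty}
  have hHlen : ∀ t ∈ H, ∀ x ∈ closedCube (wd.c t) (wd.s t),
      wd.s s + dist x (wd.c s) ≤ A * wd.s t := by
    rintro t ⟨_, ⟨τ, hτ, rfl⟩, hτt⟩ x hx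
    have h1 := distBd_le_of_mem_closedCube wd hτt
    have h2 : τ / C ≤ distBd Ω (γ τ) := hγJ τ hτ
    rw [div_le_iff₀ (by linarith)] at h2
    have h3 : dist (wd.c s) (γ τ) ≤ τ := by
      have := hγd 0 ⟨le_rfl, hL⟩ τ hτ
      rwa [hγ0, zero_sub, abs_neg, abs_of_nonneg hτ.1] at this
    have h4 := distBd_ge_of_mem_closedCube wd (center_mem_closedCube wd s)
    have h5 := distBd_le_add_dist (Ω := Ω) (wd.c s) (γ τ)
    have h6 := dist_le_of_mem_closedCube (wd.s_pos t).le hx hτt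
    have h7 := dist_triangle x (γ τ) (wd.c s)
    rw [dist_comm (γ τ)] at h7
    have h8 : wd.s s ≤ √n * wd.s s := le_mul_of_one_le_left hs.le hn'
    have h9 : distBd Ω (γ τ) * C ≤ 5 * √n * wd.s t * C :=
      mul_le_mul_of_nonneg_right h1 (by linarith)
    have : A * wd.s t = √n * wd.s t + 5 * √n * wd.s t + 2 * (5 * √n * wd.s t * C) := by
      simp only [A]; ring
    linarith
  have hHfin : H.Finite := by
    refine (finite_side_ge wd hΩb (δ := wd.s s / A) (by positivity)).subset fun t ht => ?_
    have := hHlen t ht _ (center_mem_closedCube wd t)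
    rw [mem_ofPred_eq, div_le_iff₀ hA]
    linarith [dist_nonneg (x := wd.c t) (y := wd.c s)]
  obtain ⟨w, hw⟩ := exists_walk_of_isPreconnected wd hpre (image_subset_iff.2 hγΩ) hHfin
    (fun t ht => ht) (a := s) (b := root)
    ⟨_, ⟨0, ⟨le_rfl, hL⟩, hγ0⟩, center_mem_closedCube wd s⟩
    ⟨_, ⟨L, ⟨hL, le_rfl⟩, hγL⟩, hroot'⟩
  refine ⟨w.toPath, ?_⟩
  rw [← List.sum_toFinset _ w.toPath.2.support_nodup]
  refine sum_inv_side_le wd _ (wd.c s) hs hA fun t ht x hx => ?_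
  exact hHlen t (hw t (w.support_toPath_subset_support (List.mem_toFinset.1 ht))) x
    (openCube_subset_closedCube _ _ hx)

end JohnChains

section Tree

variable {n : ℕ} {Ω : Set (Euc n)} {Γ : Type}

/-- Up to a common factor, the inverse side lengths of the Whitney cubes of a bounded domain are
positive integers. -/
lemma exists_nat_inv_side (hn : 0 < n) (hΩb : Bornology.IsBounded Ω) (wd : WhitneyDecomp n Ω Γ) :
    ∃ κ : ℝ, 0 < κ ∧ ∃ cost : Γ → ℕ, ∀ t, 0 < cost t ∧ (cost t : ℝ) * wd.s t = κ := by
  have hn' := one_le_sqrt_natCast hn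
  obtain ⟨m, hm⟩ := pow_unbounded_of_one_lt (Metric.diam Ω) (one_lt_two (α := ℝ))
  refine ⟨2 ^ m, by positivity, ?_⟩
  have : ∀ t, ∃ j : ℕ, 0 < j ∧ (j : ℝ) * wd.s t = 2 ^ m := by
    intro t
    obtain ⟨k, hk, -⟩ := wd.dyadic t
    have h1 : wd.s t < 2 ^ m := by
      have h2 := Metric.diam_mono (closedCube_subset_domain wd t) hΩb
      rw [diam_closedCube _ (wd.s_pos t).le] at h2
      have := le_mul_of_one_le_left (wd.s_pos t).le hn'
      linarith
    rw [hk, ← zpow_natCast, zpow_lt_zpow_iff_right₀ one_lt_two] at h1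
    refine ⟨2 ^ ((m : ℤ) - k).toNat, by positivity, ?_⟩
    rw [hk, Nat.cast_pow, Nat.cast_ofNat, ← zpow_natCast, Int.toNat_of_nonneg (by omega),
      ← zpow_add₀ two_ne_zero, sub_add_cancel, zpow_natCast]
  choose cost hcost using this
  exact ⟨cost, hcost⟩

/-- The least cost of a walk from `s` to `root`, when visiting a vertex `t` costs `cost t`. -/
def minCost (G : SimpleGraph Γ) (cost : Γ → ℕ) (root s : Γ) : ℕ :=
  sInf {m | ∃ w : G.Walk s root, (w.support.map cost).sum = m}

lemma exists_walk_minCost {G : SimpleGraph Γ} (cost : Γ → ℕ) {root s : Γ} (w : G.Walk s root) :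
    ∃ w : G.Walk s root, (w.support.map cost).sum = minCost G cost root s :=
  Nat.sInf_mem (s := {m | ∃ w : G.Walk s root, (w.support.map cost).sum = m}) ⟨_, w, rfl⟩

lemma minCost_le {G : SimpleGraph Γ} (cost : Γ → ℕ) {root s : Γ} (w : G.Walk s root) :
    minCost G cost root s ≤ (w.support.map cost).sum :=
  Nat.sInf_le ⟨w, rfl⟩

lemma cost_le_minCost {G : SimpleGraph Γ} (cost : Γ → ℕ) {root s : Γ} (w : G.Walk s root) :
    cost s ≤ minCost G cost root s := by
  obtain ⟨w, hw⟩ := exists_walk_minCost cost w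
  rw [← hw]
  exact List.single_le_sum (by simp) _ (List.mem_map_of_mem w.start_mem_support)

lemma exists_adj_minCost_le {G : SimpleGraph Γ} (cost : Γ → ℕ) {root s : Γ} (w : G.Walk s root)
    (hs : s ≠ root) :
    ∃ t, G.Adj s t ∧ minCost G cost root t + cost s ≤ minCost G cost root s := by
  obtain ⟨w, hw⟩ := exists_walk_minCost cost w
  cases w with
  | nil => exact absurd rfl hs
  | cons h w =>
    refine ⟨_, h, ?_⟩
    rw [← hw, SimpleGraph.Walk.support_cons, List.map_cons, List.sum_cons, add_comm]
    exact Nat.add_le_add_left (minCost_le cost w) _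

/-- A rooted tree on `Γ`, given by a parent map and the depth function. -/
structure IndexTree (Γ : Type) where
  root : Γ
  parent : Γ → Γ
  depth : Γ → ℕ
  depth_eq_zero : ∀ s, depth s = 0 ↔ s = root
  depth_parent : ∀ s, s ≠ root → depth s = depth (parent s) + 1

lemma exists_indexTree (root : Γ) (parent : Γ → Γ) (D : Γ → ℕ)
    (h : ∀ s, s ≠ root → D (parent s) < D s) :
    ∃ T : IndexTree Γ, T.root = root ∧ T.parent = parent := by
  classical
  have hreach : ∀ m s, D s ≤ m → ∃ k, parent^[k] s = root := by
    intro m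
    induction m with
    | zero =>
      intro s hs
      refine ⟨0, ?_⟩
      by_contra hne
      have := h s hne
      omega
    | succ m ih =>
      intro s hs
      by_cases hne : s = root
      · exact ⟨0, hne⟩
      · obtain ⟨k, hk⟩ := ih (parent s) (by have := h s hne; omega)
        exact ⟨k + 1, by rwa [Function.iterate_succ_apply]⟩
  have hreach' : ∀ s, ∃ k, parent^[k] s = root := fun s => hreach _ s le_rfl
  refine ⟨⟨root, parent, fun s => Nat.find (hreach' s), fun s => ?_, fun s hs => ?_⟩, rfl, rfl⟩
  · simp
  · exact Nat.find_comp_succ (hreach' s) (hreach' (parent s)) hs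

namespace IndexTree

variable (T : IndexTree Γ)

lemma depth_iterate {s : Γ} {k : ℕ} (hk : k ≤ T.depth s) :
    T.depth (T.parent^[k] s) = T.depth s - k := by
  induction k with
  | zero => rfl
  | succ k ih =>
    have h1 := ih (by omega)
    have hne : T.parent^[k] s ≠ T.root := fun h => by
      rw [(T.depth_eq_zero _).2 h] at h1; omega
    have h2 := T.depth_parent _ hne
    rw [Function.iterate_succ_apply']
    omega

lemma iterate_ne_root {s : Γ} {k : ℕ} (hk : k < T.depth s) : T.parent^[k] s ≠ T.root := by
  intro h
  have := T.depth_iterate hk.le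
  rw [(T.depth_eq_zero _).2 h] at this
  omega

lemma iterate_depth (s : Γ) : T.parent^[T.depth s] s = T.root := by
  rw [← T.depth_eq_zero, T.depth_iterate le_rfl, Nat.sub_self]

lemma iterate_injOn {s : Γ} {j k : ℕ} (hj : j ≤ T.depth s) (hk : k ≤ T.depth s)
    (h : T.parent^[j] s = T.parent^[k] s) : j = k := by
  have h1 := T.depth_iterate hj
  have h2 := T.depth_iterate hk
  rw [h] at h1
  omega

end IndexTree

/-- The Whitney cubes of a bounded John domain form a tree of touching cubes in which every cube,
suitably dilated, contains all its descendants. -/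
theorem exists_johnTree (hn : 0 < n) (hΩb : Bornology.IsBounded Ω) (hJ : IsJohnDomain Ω)
    (wd : WhitneyDecomp n Ω Γ) :
    ∃ (T : IndexTree Γ) (K : ℝ), 0 < K ∧
      (∀ s, s ≠ T.root → (closedCube (wd.c s) (wd.s s) ∩
        closedCube (wd.c (T.parent s)) (wd.s (T.parent s))).Nonempty) ∧
      ∀ s k, k ≤ T.depth s → wd.s s ≤ K * wd.s (T.parent^[k] s) ∧
        dist (wd.c s) (wd.c (T.parent^[k] s)) ≤ K * wd.s (T.parent^[k] s) := by
  have hn' := one_le_sqrt_natCast hn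
  obtain ⟨κ, hκ, cost, hcost⟩ := exists_nat_inv_side hn hΩb wd
  obtain ⟨root, M, hwalk⟩ := exists_root_and_chains hn hΩb hJ wd
  set D : Γ → ℕ := minCost (whitneyGraph wd) cost root
  choose w hw using hwalk
  have hside : ∀ t, wd.s t = κ / cost t := fun t => by
    rw [eq_div_iff (by exact_mod_cast (hcost t).1.ne'), mul_comm]; exact (hcost t).2
  have hc0 : ∀ t, (0 : ℝ) < cost t := fun t => by exact_mod_cast (hcost t).1
  have hDM : ∀ s, (D s : ℝ) ≤ M * cost s := by
    intro s
    have h1 : (D s : ℝ) ≤ (((w s).support.map cost).sum : ℕ) := by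
      exact_mod_cast minCost_le cost (w s)
    have h2 : (((w s).support.map cost).sum : ℝ) =
        κ * ((w s).support.map fun t => (wd.s t)⁻¹).sum := by
      rw [Nat.cast_list_sum, List.map_map, ← List.sum_map_mul_left]
      congr 2
      funext t
      simp only [Function.comp_apply, hside, inv_div]
      field_simp
    rw [h2] at h1
    refine h1.trans ((mul_le_mul_of_nonneg_left (hw s) hκ.le).trans (le_of_eq ?_))
    rw [hside]
    have := (hc0 s).ne'
    field_simp
  have hcD : ∀ s, (cost s : ℝ) ≤ D s := fun s => by exact_mod_cast cost_le_minCost cost (w s)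
  have hD0 : ∀ s, (0 : ℝ) < D s := fun s => (hc0 s).trans_le (hcD s)
  have hM : 1 ≤ M := by
    have := (hcD root).trans (hDM root)
    exact (le_mul_iff_one_le_left (hc0 root)).1 this
  have hpar : ∀ s, ∃ t, s ≠ root → (whitneyGraph wd).Adj s t ∧ D t + cost s ≤ D s := by
    intro s
    by_cases hs : s = root
    · exact ⟨s, fun h => absurd hs h⟩
    · obtain ⟨t, ht⟩ := exists_adj_minCost_le cost (w s) hs
      exact ⟨t, fun _ => ht⟩
  choose parent hparent using hpar
  obtain ⟨T, rfl, rfl⟩ := exists_indexTree root parent D fun s hs => by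
    have := (hparent s hs).2
    have := (hcost s).1
    omega
  have hdec : ∀ s, s ≠ T.root → M * (D (T.parent s) : ℝ) ≤ (M - 1) * D s := by
    intro s hs
    have h1 : (D (T.parent s) : ℝ) + cost s ≤ D s := by exact_mod_cast (hparent s hs).2
    have h2 := hDM s
    nlinarith
  set A := 5 * √n * κ * M
  have hA : 0 < A := by positivity
  have hstep : ∀ s, s ≠ T.root → dist (wd.c s) (wd.c (T.parent s)) ≤ A / D s := by
    intro s hs
    obtain ⟨-, z, hz, hz'⟩ := (hparent s hs).1
    have h1 := dist_le_of_mem_closedCube (wd.s_pos _).le (center_mem_closedCube wd s) hz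
    have h2 := dist_le_of_mem_closedCube (wd.s_pos _).le hz'
      (center_mem_closedCube wd (T.parent s))
    have h3 : wd.s (T.parent s) ≤ 4 * wd.s s := side_le_of_inter hn wd ⟨z, hz', hz⟩
    have h4 := dist_triangle (wd.c s) z (wd.c (T.parent s))
    have h5 : dist (wd.c s) (wd.c (T.parent s)) ≤ 5 * √n * wd.s s := by nlinarith
    refine h5.trans ?_
    rw [hside, ← mul_div_assoc, div_le_div_iff₀ (hc0 s) (hD0 s)]
    have := mul_le_mul_of_nonneg_left (hDM s) (by positivity : 0 ≤ 5 * √n * κ)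
    simp only [A]
    linarith
  have hchain : ∀ s k, k ≤ T.depth s → (D (T.parent^[k] s) : ℝ) ≤ D s ∧
      dist (wd.c s) (wd.c (T.parent^[k] s)) ≤ A * (M - 1) / D (T.parent^[k] s) := by
    intro s k
    induction k with
    | zero =>
      intro _
      simp only [Function.iterate_zero, id_eq, dist_self, le_refl, true_and]
      exact div_nonneg (mul_nonneg hA.le (by linarith)) (hD0 s).le
    | succ k ih =>
      intro hk
      obtain ⟨h1, h2⟩ := ih (by omega)
      have hne := T.iterate_ne_root (s := s) (k := k) (by omega)
      rw [Function.iterate_succ_apply']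
      set t := T.parent^[k] s
      have h3 := hdec t hne
      have h4 := hstep t hne
      have h5 : D (T.parent t) + cost t ≤ D t := (hparent t hne).2
      refine ⟨le_trans (by exact_mod_cast le_trans (Nat.le_add_right _ _) h5) h1, ?_⟩
      refine (dist_triangle _ (wd.c t) _).trans ((add_le_add h2 h4).trans ?_)
      rw [← add_div, div_le_div_iff₀ (hD0 t) (hD0 _)]
      have := mul_le_mul_of_nonneg_left h3 hA.le
      linarith
  refine ⟨T, 5 * √n * M ^ 2 + M, by positivity, fun s hs => (hparent s hs).1.2,
    fun s k hk => ?_⟩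
  obtain ⟨h1, h2⟩ := hchain s k hk
  set t := T.parent^[k] s
  have hst := wd.s_pos t
  have hsq : 0 ≤ √(n : ℝ) := Real.sqrt_nonneg _
  constructor
  · have h3 : wd.s s ≤ M * wd.s t := by
      rw [hside s, hside t, ← mul_div_assoc, div_le_div_iff₀ (hc0 s) (hc0 t)]
      have := (hcD t).trans (h1.trans (hDM s))
      nlinarith
    nlinarith [mul_nonneg (mul_nonneg hsq (sq_nonneg M)) hst.le]
  · refine h2.trans ?_
    have h3 : A * (M - 1) / D t ≤ A * M / cost t := by
      rw [div_le_div_iff₀ (hD0 t) (hc0 t)]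
      have := hcD t
      have h4 : (M - 1) * (cost t : ℝ) ≤ M * D t := by nlinarith [hc0 t]
      nlinarith
    refine h3.trans ?_
    have h4 : A * M / cost t = 5 * √n * M ^ 2 * wd.s t := by
      rw [hside]; simp only [A]; ring
    rw [h4]
    nlinarith

end Tree

section Hardy

namespace IndexTree

variable {Γ : Type} (T : IndexTree Γ)

/-- The pairs `(s, k)` with `s ∈ G` for which the `k`-th ancestor of `s` exists. -/
def pairs (G : Finset Γ) : Finset (Σ _ : Γ, ℕ) :=
  G.sigma fun s => Finset.range (T.depth s + 1)

open Classical in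
/-- The pairs `(s, k)` with `s ∈ G` for which the `k`-th ancestor of `s` is `t`. -/
def desc (G : Finset Γ) (t : Γ) : Finset (Σ _ : Γ, ℕ) :=
  (T.pairs G).filter fun x => T.parent^[x.2] x.1 = t

lemma mem_pairs {G : Finset Γ} {x : Σ _ : Γ, ℕ} :
    x ∈ T.pairs G ↔ x.1 ∈ G ∧ x.2 ≤ T.depth x.1 := by
  simp [pairs]

lemma mem_desc {G : Finset Γ} {t : Γ} {x : Σ _ : Γ, ℕ} :
    x ∈ T.desc G t ↔ (x.1 ∈ G ∧ x.2 ≤ T.depth x.1) ∧ T.parent^[x.2] x.1 = t := by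
  simp [desc, mem_pairs]

lemma desc_fst_injOn (G : Finset Γ) (t : Γ) :
    Set.InjOn (fun x : Σ _ : Γ, ℕ => x.1) (T.desc G t) := by
  rintro ⟨s, k⟩ hx ⟨s', k'⟩ hy (rfl : s = s')
  rw [Finset.mem_coe, mem_desc] at hx hy
  obtain rfl : k = k' := T.iterate_injOn hx.1.2 hy.1.2 (hx.2.trans hy.2.symm)
  rfl

/-- A set of vertices containing all ancestors of its members. -/
def AncestorClosed (G : Finset Γ) : Prop :=
  ∀ s ∈ G, ∀ k ≤ T.depth s, T.parent^[k] s ∈ G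

lemma exists_ancestorClosed (F : Set Γ) (hF : F.Finite) :
    ∃ G : Finset Γ, T.AncestorClosed G ∧ F ⊆ G := by
  classical
  refine ⟨hF.toFinset.biUnion fun s =>
    (Finset.range (T.depth s + 1)).image fun k => T.parent^[k] s, fun u hu j hj => ?_,
    fun s hs => ?_⟩
  · simp only [Finset.mem_biUnion, Finset.mem_image, Finset.mem_range] at hu ⊢
    obtain ⟨s, hs, k, hk, rfl⟩ := hu
    rw [T.depth_iterate (by omega)] at hj
    exact ⟨s, hs, j + k, by omega, Function.iterate_add_apply _ _ _ _⟩
  · simp only [Finset.coe_biUnion, mem_iUnion]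
    exact ⟨s, hF.mem_toFinset.2 hs, by
      simpa using ⟨0, Nat.zero_le _, rfl⟩⟩

lemma sum_desc_sum {M : Type*} [AddCommMonoid M] {G : Finset Γ} (hG : T.AncestorClosed G)
    (f : (Σ _ : Γ, ℕ) → M) : ∑ t ∈ G, ∑ x ∈ T.desc G t, f x = ∑ x ∈ T.pairs G, f x := by
  classical
  exact Finset.sum_fiberwise_of_maps_to (fun x hx => hG _ (T.mem_pairs.1 hx).1 _
    (T.mem_pairs.1 hx).2) f

lemma sum_desc_geom {G : Finset Γ} (hG : T.AncestorClosed G) (v : Γ → ℝ) (r : ℝ) (t : Γ) :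
    ∑ x ∈ T.desc G t, v x.1 * ∑ j ∈ Finset.range (x.2 + 1), r ^ (x.2 - j) =
      ∑ y ∈ T.desc G t, r ^ y.2 * ∑ x ∈ T.desc G y.1, v x.1 := by
  simp only [Finset.mul_sum]
  rw [Finset.sum_sigma', Finset.sum_sigma']
  refine Finset.sum_nbij'
    (fun z => ⟨⟨T.parent^[z.2] z.1.1, z.1.2 - z.2⟩, ⟨z.1.1, z.2⟩⟩)
    (fun z => ⟨⟨z.2.1, z.1.2 + z.2.2⟩, z.2.2⟩) ?_ ?_ ?_ ?_ ?_
  · rintro ⟨⟨s, k⟩, j⟩ hz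
    simp only [Finset.mem_sigma, mem_desc, Finset.mem_range] at hz ⊢
    obtain ⟨⟨⟨hs, hk⟩, rfl⟩, hj⟩ := hz
    refine ⟨⟨⟨hG _ hs _ (by omega), ?_⟩, ?_⟩, ⟨hs, by omega⟩, trivial⟩
    · rw [T.depth_iterate (by omega)]; omega
    · rw [← Function.iterate_add_apply, Nat.sub_add_cancel (by omega)]
  · rintro ⟨⟨u, i⟩, ⟨s, j⟩⟩ hz
    simp only [Finset.mem_sigma, mem_desc, Finset.mem_range] at hz ⊢
    obtain ⟨⟨⟨hu, hi⟩, rfl⟩, ⟨hs, hj⟩, rfl⟩ := hz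
    rw [T.depth_iterate hj] at hi
    exact ⟨⟨⟨hs, by omega⟩, Function.iterate_add_apply _ _ _ _⟩, by omega⟩
  · rintro ⟨⟨s, k⟩, j⟩ hz
    simp only [Finset.mem_sigma, Finset.mem_range] at hz
    simp only [Nat.sub_add_cancel (by omega : j ≤ k)]
  · rintro ⟨⟨u, i⟩, ⟨s, j⟩⟩ hz
    simp only [Finset.mem_sigma, mem_desc] at hz
    simp only [Nat.add_sub_cancel, hz.2.2]
  · rintro ⟨⟨s, k⟩, j⟩ _
    exact mul_comm _ _

/-- A Carleson packing condition improves to exponential decay of the packing sums. -/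
lemma packing_exponential {G : Finset Γ} (hG : T.AncestorClosed G) {v : Γ → ℝ} {C : ℝ}
    (hC : 0 < C) (hv : ∀ s, 0 ≤ v s) (hpack : ∀ t, ∑ x ∈ T.desc G t, v x.1 ≤ C * v t) (t : Γ) :
    ∑ x ∈ T.desc G t, v x.1 * (1 + (2 * C)⁻¹) ^ x.2 ≤ 2 * C * v t := by
  set r := 1 + (2 * C)⁻¹
  have hr : r - 1 = (2 * C)⁻¹ := by simp [r]
  have hr0 : 0 ≤ r := by positivity
  have h1 : ∀ k : ℕ, r ^ k ≤ 1 + (r - 1) * ∑ j ∈ Finset.range (k + 1), r ^ (k - j) := by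
    intro k
    have h2 := Finset.sum_range_reflect (fun i => r ^ i) (k + 1)
    simp only [Nat.add_sub_cancel] at h2
    have h3 : ∀ j, k + 1 - 1 - j = k - j := fun j => by omega
    simp only [h2, Finset.sum_range_succ]
    have h4 := geom_sum_mul r k
    have h5 : 0 ≤ (r - 1) * r ^ k := mul_nonneg (by rw [hr]; positivity) (pow_nonneg hr0 k)
    linarith
  have h2 : ∑ x ∈ T.desc G t, v x.1 * r ^ x.2 ≤ ∑ x ∈ T.desc G t, v x.1 +
      (r - 1) * ∑ x ∈ T.desc G t, v x.1 * ∑ j ∈ Finset.range (x.2 + 1), r ^ (x.2 - j) := by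
    rw [Finset.mul_sum, ← Finset.sum_add_distrib]
    refine Finset.sum_le_sum fun x _ => ?_
    have := mul_le_mul_of_nonneg_left (h1 x.2) (hv x.1)
    linarith
  rw [T.sum_desc_geom hG] at h2
  have h3 : ∑ y ∈ T.desc G t, r ^ y.2 * ∑ x ∈ T.desc G y.1, v x.1 ≤
      C * ∑ y ∈ T.desc G t, v y.1 * r ^ y.2 := by
    rw [Finset.mul_sum]
    refine Finset.sum_le_sum fun y _ => ?_
    have := mul_le_mul_of_nonneg_left (hpack y.1) (pow_nonneg hr0 y.2)
    linarith
  have h4 := mul_le_mul_of_nonneg_left h3 (by rw [hr]; positivity : 0 ≤ r - 1)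
  have h5 : (r - 1) * (C * ∑ y ∈ T.desc G t, v y.1 * r ^ y.2) =
      (∑ y ∈ T.desc G t, v y.1 * r ^ y.2) / 2 := by
    rw [hr]; field_simp
  linarith [hpack t]

/-- A discrete Hardy inequality on a tree, under a Carleson packing condition. -/
theorem hardy_inequality {C q : ℝ} (hC : 0 < C) (hq : 1 < q) :
    ∃ B : ℝ, 0 < B ∧ ∀ (G : Finset Γ), T.AncestorClosed G → ∀ v b : Γ → ℝ,
      (∀ s, 0 < v s) → (∀ s, 0 ≤ b s) → (∀ t, ∑ x ∈ T.desc G t, v x.1 ≤ C * v t) →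
      ∑ t ∈ G, v t ^ (1 - q) * (∑ x ∈ T.desc G t, v x.1 * b x.1) ^ q ≤
        B * ∑ s ∈ G, v s * b s ^ q := by
  set r := 1 + (2 * C)⁻¹
  have hr1 : 1 < r := by
    have : 0 < (2 * C)⁻¹ := by positivity
    simp only [r]; linarith
  have hr0 : 0 < r := by linarith
  set ρ := r ^ (1 - q)
  have hρ0 : 0 < ρ := Real.rpow_pos_of_pos hr0 _
  have hρ1 : ρ < 1 := Real.rpow_lt_one_of_one_lt_of_neg hr1 (by linarith)
  refine ⟨(2 * C) ^ (q - 1) * (1 - ρ)⁻¹, mul_pos (Real.rpow_pos_of_pos (by linarith) _)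
    (inv_pos.2 (by linarith)), fun G hG v b hv hb hpack => ?_⟩
  have hexp := T.packing_exponential hG hC (fun s => (hv s).le) hpack
  have hterm : ∀ t, v t ^ (1 - q) * (∑ x ∈ T.desc G t, v x.1 * b x.1) ^ q ≤
      (2 * C) ^ (q - 1) * ∑ x ∈ T.desc G t, v x.1 * b x.1 ^ q * ρ ^ x.2 := by
    intro t
    set Y := ∑ x ∈ T.desc G t, v x.1 * b x.1 ^ q * ρ ^ x.2
    have hY : 0 ≤ Y := Finset.sum_nonneg fun x _ => mul_nonneg
      (mul_nonneg (hv _).le (Real.rpow_nonneg (hb _) _)) (pow_nonneg hρ0.le _)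
    have h1 := Real.inner_le_weight_mul_Lp_of_nonneg (T.desc G t) hq.le
      (fun x => v x.1 * r ^ x.2) (fun x => b x.1 / r ^ x.2)
      (fun x => mul_nonneg (hv _).le (pow_nonneg hr0.le _))
      (fun x => div_nonneg (hb _) (pow_nonneg hr0.le _))
    have h2 : ∑ x ∈ T.desc G t, v x.1 * r ^ x.2 * (b x.1 / r ^ x.2) =
        ∑ x ∈ T.desc G t, v x.1 * b x.1 := Finset.sum_congr rfl fun x _ => by
      have : r ^ x.2 ≠ 0 := pow_ne_zero _ hr0.ne'
      field_simp
    have h3 : ∑ x ∈ T.desc G t, v x.1 * r ^ x.2 * (b x.1 / r ^ x.2) ^ q = Y :=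
      Finset.sum_congr rfl fun x _ => by
        rw [Real.div_rpow (hb _) (pow_nonneg hr0.le _), ← Real.rpow_natCast, ← Real.rpow_mul hr0.le,
          ← Real.rpow_natCast, ← Real.rpow_mul hr0.le, div_eq_mul_inv, ← Real.rpow_neg hr0.le]
        have : r ^ ((1 - q) * (x.2 : ℝ)) = r ^ (x.2 : ℝ) * r ^ (-((x.2 : ℝ) * q)) := by
          rw [← Real.rpow_add hr0]; ring_nf
        rw [this]; ring
    rw [h2, h3] at h1
    have hZ : 0 ≤ ∑ x ∈ T.desc G t, v x.1 * r ^ x.2 :=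
      Finset.sum_nonneg fun x _ => mul_nonneg (hv _).le (pow_nonneg hr0.le _)
    have hq0 : 0 < q := by linarith
    have h4 : (∑ x ∈ T.desc G t, v x.1 * b x.1) ^ q ≤ (2 * C * v t) ^ (q - 1) * Y := by
      have h5 := Real.rpow_le_rpow
        (Finset.sum_nonneg fun x _ => mul_nonneg (hv _).le (hb _)) h1 hq0.le
      refine h5.trans ?_
      rw [Real.mul_rpow (Real.rpow_nonneg hZ _) (Real.rpow_nonneg hY _), ← Real.rpow_mul hZ,
        ← Real.rpow_mul hY, inv_mul_cancel₀ hq0.ne', Real.rpow_one, sub_mul, one_mul,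
        inv_mul_cancel₀ hq0.ne']
      exact mul_le_mul_of_nonneg_right (Real.rpow_le_rpow hZ (hexp t) (by linarith)) hY
    refine (mul_le_mul_of_nonneg_left h4 (Real.rpow_nonneg (hv t).le _)).trans (le_of_eq ?_)
    rw [Real.mul_rpow (by linarith) (hv t).le]
    have h6 : v t ^ (1 - q) * v t ^ (q - 1) = 1 := by
      rw [← Real.rpow_add (hv t)]; simp
    linear_combination (2 * C) ^ (q - 1) * Y * h6
  refine (Finset.sum_le_sum fun t _ => hterm t).trans ?_
  rw [← Finset.mul_sum, T.sum_desc_sum hG (fun x => v x.1 * b x.1 ^ q * ρ ^ x.2), mul_assoc]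
  refine mul_le_mul_of_nonneg_left ?_ (Real.rpow_nonneg (by linarith) _)
  rw [pairs, Finset.sum_sigma, Finset.mul_sum]
  refine Finset.sum_le_sum fun s _ => ?_
  change ∑ k ∈ Finset.range (T.depth s + 1), v s * b s ^ q * ρ ^ k ≤ _
  rw [← Finset.mul_sum, mul_comm]
  refine mul_le_mul_of_nonneg_right ?_ (mul_nonneg (hv s).le (Real.rpow_nonneg (hb s) _))
  rw [← tsum_geometric_of_lt_one hρ0.le hρ1]
  exact (summable_geometric_of_lt_one hρ0.le hρ1).sum_le_tsum _ fun k _ => pow_nonneg hρ0.le k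

end IndexTree

end Hardy

section KernelSpace

variable {n : ℕ}

lemma Hmat_add (i : Fin n) (x y : Euc n) : Hmat i (x + y) = Hmat i x + Hmat i y := by
  ext j k
  simp only [Hmat, Matrix.add_apply, PiLp.add_apply]
  split_ifs <;> ring

lemma Hmat_smul (i : Fin n) (a : ℝ) (x : Euc n) : Hmat i (a • x) = a • Hmat i x := by
  ext j k
  simp only [Hmat, Matrix.smul_apply, PiLp.smul_apply, smul_eq_mul]
  split_ifs <;> ring

lemma Hmat_add_transpose (i : Fin n) (x : Euc n) :
    Hmat i x + (Hmat i x)ᵀ = (2 * x i) • (1 : Matrix (Fin n) (Fin n) ℝ) := by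
  ext j k
  simp only [Hmat, Matrix.smul_apply, Matrix.add_apply, Matrix.transpose_apply, Matrix.one_apply,
    smul_eq_mul]
  split_ifs <;> grind

lemma continuous_Hmat (i : Fin n) : Continuous (Hmat i : Euc n → Matrix (Fin n) (Fin n) ℝ) := by
  refine continuous_matrix fun j k => ?_
  simp only [Hmat]
  split_ifs <;> fun_prop

/-- A linear parametrization of the space `V`. -/
def kernelMap (n : ℕ) : (Matrix (Fin n) (Fin n) ℝ × ℝ × (Fin n → ℝ)) →ₗ[ℝ]
    (Euc n → Matrix (Fin n) (Fin n) ℝ) where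
  toFun w x := w.1 - w.1ᵀ + w.2.1 • (1 : Matrix (Fin n) (Fin n) ℝ) + ∑ i, w.2.2 i • Hmat i x
  map_add' w w' := by
    ext x j k
    simp [Finset.sum_add_distrib, add_smul, Matrix.sum_apply, Matrix.add_apply]
    ring
  map_smul' a w := by
    ext x j k
    simp [Finset.mul_sum, Matrix.sum_apply, mul_smul, mul_add, mul_sub]

/-- The space `V` as a submodule. -/
def kernelSpace (n : ℕ) : Submodule ℝ (Euc n → Matrix (Fin n) (Fin n) ℝ) :=
  LinearMap.range (kernelMap n)

lemma mem_kernelSpace {φ : Euc n → Matrix (Fin n) (Fin n) ℝ} :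
    φ ∈ kernelSpace n ↔ φ ∈ Vset n := by
  constructor
  · rintro ⟨⟨A, l, b⟩, rfl⟩
    refine ⟨A - Aᵀ, l, b, 0, by simp, fun x => by simp [kernelMap]⟩
  · rintro ⟨A, l, b, y, hA, hφ⟩
    refine ⟨⟨(1 / 2 : ℝ) • (A - ∑ i, b i • Hmat i y), l - ∑ i, b i * y i, b⟩, ?_⟩
    funext x
    rw [hφ]
    have h1 : ∀ i, Hmat i (x - y) = Hmat i x - Hmat i y := fun i => by
      rw [eq_sub_iff_add_eq, ← Hmat_add, sub_add_cancel]
    have h2 : (∑ i, b i * y i) • (1 : Matrix (Fin n) (Fin n) ℝ) =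
        (1 / 2 : ℝ) • (∑ i, b i • Hmat i y + (∑ i, b i • Hmat i y)ᵀ) := by
      rw [Matrix.transpose_sum, ← Finset.sum_add_distrib, Finset.smul_sum, Finset.sum_smul]
      refine Finset.sum_congr rfl fun i _ => ?_
      rw [Matrix.transpose_smul, ← smul_add, Hmat_add_transpose, smul_smul, smul_smul]
      congr 1; ring
    simp only [kernelMap, LinearMap.coe_mk, AddHom.coe_mk, h1, smul_sub, Finset.sum_sub_distrib,
      sub_smul, h2, Matrix.transpose_smul, Matrix.transpose_sub, hA]
    module

instance : FiniteDimensional ℝ (kernelSpace n) :=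
  inferInstanceAs (FiniteDimensional ℝ (LinearMap.range (kernelMap n)))

lemma continuous_of_mem_Vset {φ : Euc n → Matrix (Fin n) (Fin n) ℝ} (hφ : φ ∈ Vset n) :
    Continuous φ := by
  obtain ⟨A, l, b, y, -, h⟩ := hφ
  rw [funext h]
  exact continuous_const.add (continuous_finsetSum _ fun i _ =>
    Continuous.const_smul (g := fun x => Hmat i (x - y))
      ((continuous_Hmat i).comp (continuous_id.sub continuous_const)) (b i))

lemma comp_affine_mem_Vset {φ : Euc n → Matrix (Fin n) (Fin n) ℝ} (hφ : φ ∈ Vset n) (a : ℝ)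
    (w : Euc n) : (fun x => φ (a • x + w)) ∈ Vset n := by
  rw [← mem_kernelSpace] at hφ
  obtain ⟨⟨A, l, b⟩, rfl⟩ := hφ
  have h : (∑ i, b i • Hmat i w) + (∑ i, b i • Hmat i w)ᵀ =
      (2 * ∑ i, b i * w i) • (1 : Matrix (Fin n) (Fin n) ℝ) := by
    rw [Matrix.transpose_sum, ← Finset.sum_add_distrib, Finset.mul_sum, Finset.sum_smul]
    refine Finset.sum_congr rfl fun i _ => ?_
    rw [Matrix.transpose_smul, ← smul_add, Hmat_add_transpose, smul_smul]
    congr 1; ring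
  refine ⟨A - Aᵀ + ∑ i, b i • Hmat i w - (∑ i, b i * w i) • (1 : Matrix (Fin n) (Fin n) ℝ),
    l + ∑ i, b i * w i, fun i => a * b i, 0, ?_, fun x => ?_⟩
  · have h' := eq_sub_of_add_eq' h
    rw [Matrix.transpose_sub, Matrix.transpose_add, h']
    simp only [Matrix.transpose_sub, Matrix.transpose_transpose, Matrix.transpose_smul,
      Matrix.transpose_one]
    module
  · simp only [kernelMap, LinearMap.coe_mk, AddHom.coe_mk, Hmat_add, Hmat_smul, smul_add,
      Finset.sum_add_distrib, sub_zero, smul_smul, mul_comm a]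
    module

lemma eq_zero_of_eqOn_openCube {φ : Euc n → Matrix (Fin n) (Fin n) ℝ} (hφ : φ ∈ Vset n)
    (h : ∀ x ∈ openCube (0 : Euc n) 1, φ x = 0) : φ = 0 := by
  rw [← mem_kernelSpace] at hφ
  obtain ⟨⟨A, l, b⟩, rfl⟩ := hφ
  have h0 := h 0 (center_mem_openCube _ one_pos)
  have hH : ∀ i : Fin n, Hmat i (0 : Euc n) = 0 := fun i => by
    simpa using Hmat_smul i 0 (0 : Euc n)
  simp only [kernelMap, LinearMap.coe_mk, AddHom.coe_mk, hH, smul_zero, Finset.sum_const_zero,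
    add_zero] at h0
  funext x
  obtain ⟨ε, hε, hx⟩ : ∃ ε : ℝ, 0 < ε ∧ ε • x ∈ openCube (0 : Euc n) 1 := by
    have hc : Continuous fun ε : ℝ => ε • x := by fun_prop
    have hm : (fun ε : ℝ => ε • x) ⁻¹' openCube (0 : Euc n) 1 ∈ nhds 0 :=
      hc.continuousAt.preimage_mem_nhds ((isOpen_openCube _ _).mem_nhds (by
        simpa using center_mem_openCube (0 : Euc n) one_pos))
    obtain ⟨δ, hδ, hb⟩ := Metric.mem_nhds_iff.1 hm
    exact ⟨δ / 2, by positivity, hb (by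
      rw [Metric.mem_ball, Real.dist_eq, sub_zero, abs_of_pos (by positivity)]; linarith)⟩
  have h1 := h _ hx
  simp only [kernelMap, LinearMap.coe_mk, AddHom.coe_mk, h0, zero_add, Hmat_smul,
    smul_comm _ ε, ← Finset.smul_sum] at h1
  simp only [kernelMap, LinearMap.coe_mk, AddHom.coe_mk, h0, zero_add]
  exact (smul_eq_zero.1 h1).resolve_left hε.ne'

lemma integrableOn_openCube_of_continuous {f : Euc n → ℝ} (hf : Continuous f) (c : Euc n) {h : ℝ}
    (hh : 0 ≤ h) : IntegrableOn f (openCube c h) :=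
  (hf.continuousOn.integrableOn_compact (Metric.isCompact_of_isClosed_isBounded
    (isClosed_closedCube c h) (isBounded_closedCube c hh))).mono_set (openCube_subset_closedCube c h)

lemma Continuous.matDot {X : Type*} [TopologicalSpace X] {f g : X → Matrix (Fin n) (Fin n) ℝ}
    (hf : Continuous f) (hg : Continuous g) : Continuous fun x => matDot (f x) (g x) :=
  continuous_matDot.comp (hf.prodMk hg)

/-- The `L²` pairing over the unit cube on the space `V`. -/
def kernelForm (n : ℕ) : LinearMap.BilinForm ℝ (kernelSpace n) :=
  LinearMap.mk₂ ℝ (fun φ ψ => ∫ x in openCube (0 : Euc n) 1, matDot (φ.1 x) (ψ.1 x))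
    (fun φ φ' ψ => by
      simp only [Submodule.coe_add, Pi.add_apply, matDot_add_left]
      exact integral_add
        (integrableOn_openCube_of_continuous ((continuous_of_mem_Vset (mem_kernelSpace.1 φ.2)).matDot
          (continuous_of_mem_Vset (mem_kernelSpace.1 ψ.2))) _ zero_le_one)
        (integrableOn_openCube_of_continuous ((continuous_of_mem_Vset (mem_kernelSpace.1 φ'.2)).matDot
          (continuous_of_mem_Vset (mem_kernelSpace.1 ψ.2))) _ zero_le_one))
    (fun a φ ψ => by
      simp only [Submodule.coe_smul, Pi.smul_apply, matDot_smul_left, integral_const_mul,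
        smul_eq_mul])
    (fun φ ψ ψ' => by
      simp only [Submodule.coe_add, Pi.add_apply, matDot_add_right]
      exact integral_add
        (integrableOn_openCube_of_continuous ((continuous_of_mem_Vset (mem_kernelSpace.1 φ.2)).matDot
          (continuous_of_mem_Vset (mem_kernelSpace.1 ψ.2))) _ zero_le_one)
        (integrableOn_openCube_of_continuous ((continuous_of_mem_Vset (mem_kernelSpace.1 φ.2)).matDot
          (continuous_of_mem_Vset (mem_kernelSpace.1 ψ'.2))) _ zero_le_one))
    (fun a φ ψ => by
      simp only [Submodule.coe_smul, Pi.smul_apply, matDot_smul_right, integral_const_mul,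
        smul_eq_mul])

lemma kernelForm_apply (φ ψ : kernelSpace n) :
    kernelForm n φ ψ = ∫ x in openCube (0 : Euc n) 1, matDot (φ.1 x) (ψ.1 x) := rfl

lemma eq_zero_of_kernelForm_self {φ : kernelSpace n} (h : kernelForm n φ φ = 0) : φ = 0 := by
  have hφ := mem_kernelSpace.1 φ.2
  have hc := continuous_of_mem_Vset hφ
  refine Subtype.ext (eq_zero_of_eqOn_openCube hφ fun x hx => ?_)
  rw [kernelForm_apply] at h
  have hint := integrableOn_openCube_of_continuous (hc.matDot hc) (0 : Euc n) zero_le_one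
  rw [setIntegral_eq_zero_iff_of_nonneg_ae (Filter.Eventually.of_forall fun x => by
    rw [matDot_self]; positivity) hint] at h
  have h1 : EqOn (fun x => matDot (φ.1 x) (φ.1 x)) 0 (openCube (0 : Euc n) 1) :=
    Measure.eqOn_open_of_ae_eq h (isOpen_openCube _ _) (hc.matDot hc).continuousOn
      continuousOn_const
  have h2 := h1 hx
  simp only [matDot_self, Pi.zero_apply] at h2
  exact matNorm_eq_zero.1 (pow_eq_zero_iff two_ne_zero |>.1 h2)

lemma exists_reproducing_family (n : ℕ) :
    ∃ (N : ℕ) (φ ψ : Fin N → Euc n → Matrix (Fin n) (Fin n) ℝ),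
      (∀ k, φ k ∈ Vset n) ∧ (∀ k, ψ k ∈ Vset n) ∧ ∀ η ∈ Vset n, ∀ x,
        η x = ∑ k, (∫ y in openCube (0 : Euc n) 1, matDot (ψ k y) (η y)) • φ k x := by
  have hB : (kernelForm n).Nondegenerate := by
    constructor
    · exact fun φ h => eq_zero_of_kernelForm_self (h φ)
    · exact fun φ h => eq_zero_of_kernelForm_self (h φ)
  set b := Module.finBasis ℝ (kernelSpace n)
  set d := (kernelForm n).dualBasis hB b
  refine ⟨_, fun k => (b k).1, fun k => (d k).1, fun k => mem_kernelSpace.1 (b k).2,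
    fun k => mem_kernelSpace.1 (d k).2, fun η hη x => ?_⟩
  have h1 := b.sum_repr ⟨η, mem_kernelSpace.2 hη⟩
  have h2 : ∀ k, b.repr ⟨η, mem_kernelSpace.2 hη⟩ k =
      kernelForm n (d k) ⟨η, mem_kernelSpace.2 hη⟩ := fun k => by
    conv_rhs => rw [← h1, map_sum]
    simp only [map_smul, d, LinearMap.BilinForm.apply_dualBasis_left, smul_eq_mul, mul_ite,
      mul_one, mul_zero]
    rw [Finset.sum_ite_eq' Finset.univ k, if_pos (Finset.mem_univ k)]
  have h3 := congrFun (congrArg Subtype.val h1) x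
  simp only [h2, kernelForm_apply, Submodule.coe_sum, Submodule.coe_smul, Finset.sum_apply,
    Pi.smul_apply] at h3
  exact h3.symm

lemma exists_matNorm_bound_on_closedBall {φ : Euc n → Matrix (Fin n) (Fin n) ℝ}
    (hφ : Continuous φ) (R : ℝ) :
    ∃ C, 0 ≤ C ∧ ∀ x ∈ closedBall (0 : Euc n) R, matNorm (φ x) ≤ C := by
  obtain ⟨C, hC⟩ := (isCompact_closedBall (0 : Euc n) R).exists_bound_of_continuousOn
    (continuous_matNorm.comp hφ).continuousOn
  exact ⟨|C|, abs_nonneg C, fun x hx =>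
    (le_abs_self _).trans ((hC x hx).trans (le_abs_self C))⟩

instance : TopologicalSpace.PseudoMetrizableSpace (Matrix (Fin n) (Fin n) ℝ) :=
  inferInstanceAs (TopologicalSpace.PseudoMetrizableSpace (Fin n → Fin n → ℝ))

lemma integrableOn_matDot {X : Set (Euc n)} (hX : Bornology.IsBounded X)
    (hXm : MeasurableSet X) {f φ : Euc n → Matrix (Fin n) (Fin n) ℝ}
    (hfm : AEStronglyMeasurable f (volume.restrict X))
    (hfi : IntegrableOn (fun x => matNorm (f x)) X) (hφ : Continuous φ) :
    IntegrableOn (fun x => matDot (f x) (φ x)) X := by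
  obtain ⟨R, hR⟩ := hX.subset_closedBall (0 : Euc n)
  obtain ⟨C, hC, hb⟩ := exists_matNorm_bound_on_closedBall hφ R
  have hm : AEStronglyMeasurable (fun x => matDot (f x) (φ x)) (volume.restrict X) := by
    have h1 : AEStronglyMeasurable φ (volume.restrict X) := hφ.aestronglyMeasurable
    exact Continuous.comp_aestronglyMeasurable
      (g := fun P : Matrix (Fin n) (Fin n) ℝ × Matrix (Fin n) (Fin n) ℝ => matDot P.1 P.2)
      (f := fun x => (f x, φ x)) continuous_matDot (hfm.prodMk h1)
  refine Integrable.mono' (hfi.mul_const C) hm ?_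
  filter_upwards [ae_restrict_mem hXm] with x hx
  exact (abs_matDot_le _ _).trans (mul_le_mul_of_nonneg_left (hb x (hR hx)) (matNorm_nonneg _))

lemma mem_openCube_iff_rescale {x₀ z : Euc n} {h : ℝ} (hh : 0 < h) :
    z ∈ openCube x₀ h ↔ h⁻¹ • (z - x₀) ∈ openCube (0 : Euc n) 1 := by
  refine forall_congr' fun i => ?_
  simp only [PiLp.smul_apply, PiLp.sub_apply, PiLp.zero_apply, sub_zero, smul_eq_mul, abs_mul,
    abs_inv, abs_of_pos hh]
  rw [inv_mul_lt_iff₀ hh, mul_one_div]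

lemma setIntegral_openCube_rescale (F : Euc n → ℝ) (x₀ : Euc n) {h : ℝ} (hh : 0 < h) :
    ∫ z in openCube x₀ h, F (h⁻¹ • (z - x₀)) = h ^ n * ∫ w in openCube (0 : Euc n) 1, F w := by
  rw [← integral_indicator (measurableSet_openCube _ _),
    ← integral_indicator (measurableSet_openCube _ _)]
  have h1 : (openCube x₀ h).indicator (fun z => F (h⁻¹ • (z - x₀))) =
      fun z => (openCube (0 : Euc n) 1).indicator F (h⁻¹ • (z - x₀)) := by
    funext z
    by_cases hz : z ∈ openCube x₀ h
    · rw [indicator_of_mem hz, indicator_of_mem ((mem_openCube_iff_rescale hh).1 hz)]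
    · rw [indicator_of_notMem hz, indicator_of_notMem (fun h' =>
        hz ((mem_openCube_iff_rescale hh).2 h'))]
  rw [h1, integral_sub_right_eq_self
    (fun z => (openCube (0 : Euc n) 1).indicator F (h⁻¹ • z)) x₀,
    Measure.integral_comp_inv_smul, finrank_euclideanSpace_fin, smul_eq_mul,
    abs_of_pos (pow_pos hh n)]

/-- Moments against `V` can be moved onto any cube comparable with the support. -/
theorem exists_localized_field (n : ℕ) (K : ℝ) :
    ∃ C : ℝ, 0 < C ∧ ∀ (Ω : Set (Euc n)), IsOpen Ω → Bornology.IsBounded Ω →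
      ∀ (x₀ : Euc n) (h : ℝ), 0 < h → openCube x₀ h ⊆ Ω →
      ∀ f : Euc n → Matrix (Fin n) (Fin n) ℝ,
      AEStronglyMeasurable f (volume.restrict Ω) → IntegrableOn (fun x => matNorm (f x)) Ω →
      Function.support f ⊆ closedBall x₀ (K * h) →
      ∃ P : Euc n → Matrix (Fin n) (Fin n) ℝ, Function.support P ⊆ openCube x₀ h ∧
        AEStronglyMeasurable P (volume.restrict Ω) ∧
        (∀ z, matNorm (P z) ≤ C * (h ^ n)⁻¹ * ∫ x in Ω, matNorm (f x)) ∧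
        ∀ η ∈ Vset n, ∫ x in Ω, matDot (P x) (η x) = ∫ x in Ω, matDot (f x) (η x) := by
  obtain ⟨N, φ, ψ, hφ, hψ, hrep⟩ := exists_reproducing_family n
  have hφc := fun k => continuous_of_mem_Vset (hφ k)
  have hψc := fun k => continuous_of_mem_Vset (hψ k)
  choose Cφ hCφ hbφ using fun k => exists_matNorm_bound_on_closedBall (hφc k) K
  obtain ⟨R, hR⟩ := (isBounded_closedCube (0 : Euc n) zero_le_one).subset_closedBall 0
  choose Cψ hCψ hbψ using fun k => exists_matNorm_bound_on_closedBall (hψc k) R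
  refine ⟨∑ k, Cφ k * Cψ k + 1, add_pos_of_nonneg_of_pos (Finset.sum_nonneg fun k _ =>
    mul_nonneg (hCφ k) (hCψ k)) one_pos, fun Ω hΩo hΩb x₀ h hh hsub f hfm hfi hsupp => ?_⟩
  set I := ∫ x in Ω, matNorm (f x)
  have hI : 0 ≤ I := integral_nonneg fun x => matNorm_nonneg _
  have haff : ∀ x, h⁻¹ • (x - x₀) = h⁻¹ • x + -(h⁻¹ • x₀) := fun x => by
    rw [smul_sub, sub_eq_add_neg]
  have hmem : ∀ ξ ∈ Vset n, (fun x => ξ (h⁻¹ • (x - x₀))) ∈ Vset n := fun ξ hξ => by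
    simp only [haff]; exact comp_affine_mem_Vset hξ _ _
  set m : Fin N → ℝ := fun k => ∫ x in Ω, matDot (f x) (φ k (h⁻¹ • (x - x₀)))
  have hm : ∀ k, |m k| ≤ Cφ k * I := by
    intro k
    have hb := norm_integral_le_of_norm_le (f := fun x => matDot (f x) (φ k (h⁻¹ • (x - x₀))))
      (hfi.const_mul (Cφ k)) (Filter.Eventually.of_forall fun x => ?_)
    · rwa [integral_const_mul] at hb
    rw [Real.norm_eq_abs]
    refine (abs_matDot_le _ _).trans ?_
    by_cases hx : f x = 0
    · simp [hx]
    · have hx' := hsupp (Function.mem_support.2 hx)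
      rw [mem_closedBall, dist_eq_norm] at hx'
      rw [mul_comm]
      refine mul_le_mul_of_nonneg_right (hbφ k _ ?_) (matNorm_nonneg _)
      rw [mem_closedBall, dist_zero_right, norm_smul, norm_inv, Real.norm_of_nonneg hh.le,
        inv_mul_le_iff₀ hh, mul_comm]
      exact hx'
  set D : Euc n → Matrix (Fin n) (Fin n) ℝ := fun z =>
    (h ^ n)⁻¹ • ∑ k, m k • ψ k (h⁻¹ • (z - x₀)) with hD
  have hDc : Continuous D := by
    have : ∀ k, Continuous fun z : Euc n => ψ k (h⁻¹ • (z - x₀)) := fun k =>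
      (hψc k).comp (by fun_prop)
    exact Continuous.const_smul (g := fun z => ∑ k, m k • ψ k (h⁻¹ • (z - x₀)))
      (continuous_finsetSum _ fun k _ =>
        Continuous.const_smul (g := fun z => ψ k (h⁻¹ • (z - x₀))) (this k) (m k)) (h ^ n)⁻¹
  refine ⟨(openCube x₀ h).indicator D, support_indicator_subset,
    hDc.aestronglyMeasurable.indicator (measurableSet_openCube _ _), fun z => ?_, fun η hη => ?_⟩
  · by_cases hz : z ∈ openCube x₀ h
    · rw [indicator_of_mem hz, matNorm_smul, abs_of_pos (inv_pos.2 (pow_pos hh n)),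
        mul_comm _ (h ^ n)⁻¹, mul_assoc]
      refine mul_le_mul_of_nonneg_left ?_ (inv_nonneg.2 (pow_nonneg hh.le n))
      refine (matNorm_sum_le _ _).trans ?_
      rw [add_mul, Finset.sum_mul, one_mul]
      refine (Finset.sum_le_sum fun k _ => ?_).trans (le_add_of_nonneg_right hI)
      rw [matNorm_smul]
      refine (mul_le_mul (hm k) (hbψ k _ (hR (openCube_subset_closedCube _ _
        ((mem_openCube_iff_rescale hh).1 hz)))) (matNorm_nonneg _)
        (mul_nonneg (hCφ k) hI)).trans (le_of_eq (by ring))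
    · rw [indicator_of_notMem hz, matNorm_zero]
      have : 0 ≤ ∑ k, Cφ k * Cψ k := Finset.sum_nonneg fun k _ => mul_nonneg (hCφ k) (hCψ k)
      positivity
  · set ξ : Euc n → Matrix (Fin n) (Fin n) ℝ := fun w => η (h • w + x₀)
    have hξ : ξ ∈ Vset n := comp_affine_mem_Vset hη h x₀
    have hξη : ∀ x, η x = ξ (h⁻¹ • (x - x₀)) := fun x => by
      simp only [ξ, smul_smul, mul_inv_cancel₀ hh.ne', one_smul, sub_add_cancel]
    have hleft : ∫ x in Ω, matDot ((openCube x₀ h).indicator D x) (η x) =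
        ∑ k, m k * ∫ y in openCube (0 : Euc n) 1, matDot (ψ k y) (ξ y) := by
      have h1 : ∀ x, matDot ((openCube x₀ h).indicator D x) (η x) =
          (openCube x₀ h).indicator (fun x => matDot (D x) (η x)) x := fun x => by
        by_cases hx : x ∈ openCube x₀ h
        · simp [indicator_of_mem hx]
        · simp [indicator_of_notMem hx]
      simp only [h1]
      rw [setIntegral_indicator (measurableSet_openCube _ _), inter_eq_right.2 hsub]
      have h2 : ∀ x, matDot (D x) (η x) =
          (fun w => (h ^ n)⁻¹ * ∑ k, m k * matDot (ψ k w) (ξ w)) (h⁻¹ • (x - x₀)) := fun x => by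
        rw [hξη x]
        simp only [hD, matDot_smul_left, matDot_sum_left]
      simp only [h2]
      rw [setIntegral_openCube_rescale
        (fun w => (h ^ n)⁻¹ * ∑ k, m k * matDot (ψ k w) (ξ w)) _ hh, integral_const_mul, ← mul_assoc,
        mul_inv_cancel₀ (pow_pos hh n).ne', one_mul, integral_finsetSum]
      · simp only [integral_const_mul]
      · exact fun k _ => (integrableOn_openCube_of_continuous
          ((hψc k).matDot (continuous_of_mem_Vset hξ)) _ zero_le_one).const_mul _
    have hright : ∫ x in Ω, matDot (f x) (η x) =
        ∑ k, (∫ y in openCube (0 : Euc n) 1, matDot (ψ k y) (ξ y)) * m k := by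
      have h1 : ∀ x, matDot (f x) (η x) = ∑ k, (∫ y in openCube (0 : Euc n) 1,
          matDot (ψ k y) (ξ y)) * matDot (f x) (φ k (h⁻¹ • (x - x₀))) := fun x => by
        rw [hξη x, hrep ξ hξ, matDot_sum_right]
        simp only [matDot_smul_right]
      simp only [h1]
      rw [integral_finsetSum]
      · simp only [integral_const_mul, m]
      · exact fun k _ => (integrableOn_matDot hΩb hΩo.measurableSet hfm hfi
          (continuous_of_mem_Vset (hmem _ (hφ k)))).const_mul _
    rw [hleft, hright]
    exact Finset.sum_congr rfl fun k _ => mul_comm _ _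

end KernelSpace

section WeightedEstimates

variable {n : ℕ} {Ω : Set (Euc n)} {Γ : Type}

lemma exists_measurable_partition (wd : WhitneyDecomp n Ω Γ) :
    ∃ E : Γ → Set (Euc n), (∀ t, MeasurableSet (E t)) ∧ Pairwise (Function.onFun Disjoint E) ∧
      (⋃ t, E t) = Ω ∧ ∀ t, E t ⊆ closedCube (wd.c t) (wd.s t) := by
  have := countable_index wd
  obtain ⟨f, hf⟩ := exists_injective_nat Γ
  refine ⟨fun t => closedCube (wd.c t) (wd.s t) \
    ⋃ (s : Γ) (_ : f s < f t), closedCube (wd.c s) (wd.s s), fun t => ?_, fun s t hst => ?_, ?_,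
    fun t => sdiff_subset⟩
  · exact (isClosed_closedCube _ _).measurableSet.diff (MeasurableSet.iUnion fun s =>
      MeasurableSet.iUnion fun _ => (isClosed_closedCube _ _).measurableSet)
  · refine Set.disjoint_left.2 fun x hs ht => ?_
    rcases lt_or_gt_of_ne (hf.ne hst) with h | h
    · exact ht.2 (mem_iUnion₂.2 ⟨s, h, hs.1⟩)
    · exact hs.2 (mem_iUnion₂.2 ⟨t, h, ht.1⟩)
  · refine subset_antisymm (iUnion_subset fun t =>
      sdiff_subset.trans (closedCube_subset_domain wd t)) fun x hx => ?_
    rw [← wd.cover, mem_iUnion] at hx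
    set X : Set Γ := {t | x ∈ closedCube (wd.c t) (wd.s t)}
    obtain ⟨t, ht, hmin⟩ := (measure f).wf.has_min X hx
    refine mem_iUnion.2 ⟨t, ht, fun hu => ?_⟩
    obtain ⟨s, hs, hxs⟩ := mem_iUnion₂.1 hu
    exact hmin s hxs hs

lemma add_rpow_le_two_rpow_mul {x y q : ℝ} (hx : 0 ≤ x) (hy : 0 ≤ y) (hq : 0 ≤ q) :
    (x + y) ^ q ≤ 2 ^ q * (x ^ q + y ^ q) := by
  have hx' := Real.rpow_nonneg hx q
  have hy' := Real.rpow_nonneg hy q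
  have h2 : (0 : ℝ) ≤ 2 ^ q := by positivity
  rcases le_total x y with h | h
  · refine (Real.rpow_le_rpow (by linarith) (by linarith : x + y ≤ 2 * y) hq).trans ?_
    rw [Real.mul_rpow two_pos.le hy]
    exact mul_le_mul_of_nonneg_left (by linarith) h2
  · refine (Real.rpow_le_rpow (by linarith) (by linarith : x + y ≤ 2 * x) hq).trans ?_
    rw [Real.mul_rpow two_pos.le hx]
    exact mul_le_mul_of_nonneg_left (by linarith) h2

lemma distBd_rpow_nonneg (x : Euc n) (a : ℝ) : 0 ≤ distBd Ω x ^ a :=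
  Real.rpow_nonneg Metric.infDist_nonneg a

lemma measurable_distBd_rpow (a : ℝ) : Measurable fun x : Euc n => distBd Ω x ^ a :=
  (Metric.continuous_infDist_pt _).measurable.pow_const a

lemma rpow_integral_le_of_nonneg {X : Type*} [MeasurableSpace X] {μ : Measure X}
    [IsFiniteMeasure μ] {f : X → ℝ} {q : ℝ} (hq : 1 < q) (hf0 : ∀ x, 0 ≤ f x)
    (hf : AEStronglyMeasurable f μ) (hfq : Integrable (fun x => f x ^ q) μ) :
    (∫ x, f x ∂μ) ^ q ≤ μ.real univ ^ (q - 1) * ∫ x, f x ^ q ∂μ := by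
  have hq0 : 0 < q := by linarith
  have hc : q.HolderConjugate (Real.conjExponent q) := .conjExponent hq
  have hmem : MemLp f (ENNReal.ofReal q) μ := by
    rw [← integrable_norm_rpow_iff hf (by simpa using hq0) ENNReal.ofReal_ne_top,
      ENNReal.toReal_ofReal hq0.le]
    simpa only [Real.norm_of_nonneg (hf0 _)] using hfq
  have h1 := integral_mul_le_Lp_mul_Lq_of_nonneg (μ := μ) hc (f := f) (g := fun _ => 1)
    (Filter.Eventually.of_forall hf0) (Filter.Eventually.of_forall fun _ => zero_le_one) hmem
    (memLp_const 1)
  simp only [mul_one, Real.one_rpow, integral_const, smul_eq_mul] at h1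
  have hI : 0 ≤ ∫ x, f x ^ q ∂μ := integral_nonneg fun x => Real.rpow_nonneg (hf0 x) q
  have h2 := Real.rpow_le_rpow (integral_nonneg hf0) h1 hq0.le
  refine h2.trans (le_of_eq ?_)
  rw [Real.mul_rpow (Real.rpow_nonneg hI _) (Real.rpow_nonneg measureReal_nonneg _),
    ← Real.rpow_mul hI, ← Real.rpow_mul measureReal_nonneg, one_div_mul_cancel hq0.ne',
    Real.rpow_one, mul_comm, Real.conjExponent]
  congr 2
  have : q - 1 ≠ 0 := by linarith
  field_simp

lemma rpow_integral_matNorm_le (hn : 0 < n) (wd : WhitneyDecomp n Ω Γ) {q β : ℝ} (hq : 1 < q)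
    (hβ : 0 ≤ β) {t : Γ} {E : Set (Euc n)} (hE : MeasurableSet E)
    (hEt : E ⊆ closedCube (wd.c t) (wd.s t)) {g : Euc n → Matrix (Fin n) (Fin n) ℝ}
    (hgm : AEStronglyMeasurable g (volume.restrict Ω))
    (hgq : IntegrableOn (fun x => matNorm (g x) ^ q * distBd Ω x ^ (-(q * β))) Ω) :
    (∫ x in E, matNorm (g x)) ^ q ≤ (wd.s t ^ n) ^ (q - 1) * (6 * √n * wd.s t) ^ (q * β) *
      ∫ x in E, matNorm (g x) ^ q * distBd Ω x ^ (-(q * β)) := by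
  have hs := wd.s_pos t
  have hn' := one_le_sqrt_natCast hn
  have hEΩ : E ⊆ Ω := hEt.trans (closedCube_subset_domain wd t)
  have hD : 0 < 6 * √n * wd.s t := by positivity
  have hqβ : 0 ≤ q * β := by positivity
  have hvol : volume E ≤ ENNReal.ofReal (wd.s t ^ n) :=
    (measure_mono hEt).trans (volume_closedCube _ hs.le).le
  have hfin : IsFiniteMeasure (volume.restrict E) :=
    ⟨by rw [Measure.restrict_apply_univ]; exact hvol.trans_lt ENNReal.ofReal_lt_top⟩
  have hgE : AEStronglyMeasurable g (volume.restrict E) := hgm.mono_set hEΩ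
  have hm : AEStronglyMeasurable (fun x => matNorm (g x)) (volume.restrict E) :=
    continuous_matNorm.comp_aestronglyMeasurable hgE
  have hgqE := hgq.mono_set hEΩ
  have hpt : ∀ x ∈ E, matNorm (g x) ^ q ≤
      (6 * √n * wd.s t) ^ (q * β) * (matNorm (g x) ^ q * distBd Ω x ^ (-(q * β))) := by
    intro x hx
    have hxe := closedCube_subset_extCube wd t (hEt hx)
    have hρ : 0 < distBd Ω x := by linarith [distBd_ge_of_mem_extCube hn wd hxe]
    have h1 : 1 ≤ (6 * √n * wd.s t) ^ (q * β) * distBd Ω x ^ (-(q * β)) := by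
      rw [Real.rpow_neg hρ.le, ← div_eq_mul_inv, one_le_div (Real.rpow_pos_of_pos hρ _)]
      exact Real.rpow_le_rpow hρ.le (distBd_le_of_mem_extCube wd hxe) hqβ
    have h2 := mul_le_mul_of_nonneg_left h1 (Real.rpow_nonneg (matNorm_nonneg (g x)) q)
    linarith
  have hint : IntegrableOn (fun x => matNorm (g x) ^ q) E := by
    refine Integrable.mono' (hgqE.const_mul ((6 * √n * wd.s t) ^ (q * β)))
      (hm.aemeasurable.pow_const q).aestronglyMeasurable ?_
    filter_upwards [ae_restrict_mem hE] with x hx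
    rw [Real.norm_of_nonneg (Real.rpow_nonneg (matNorm_nonneg _) _)]
    exact hpt x hx
  refine (rpow_integral_le_of_nonneg hq (fun x => matNorm_nonneg (g x)) hm hint).trans ?_
  rw [mul_assoc]
  refine mul_le_mul ?_ ?_ (integral_nonneg fun x => Real.rpow_nonneg (matNorm_nonneg _) _)
    (by positivity)
  · refine Real.rpow_le_rpow measureReal_nonneg ?_ (by linarith)
    rw [measureReal_restrict_apply_univ]
    exact ENNReal.toReal_le_of_le_ofReal (by positivity) hvol
  · rw [← integral_const_mul]
    exact setIntegral_mono_on hint (hgqE.const_mul _) hE hpt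

lemma integral_extCube_le (hn : 0 < n) (hΩo : IsOpen Ω) (wd : WhitneyDecomp n Ω Γ) {q β : ℝ}
    (hq : 1 < q) (hβ : 0 ≤ β) {t : Γ} {E : Set (Euc n)} (hE : MeasurableSet E)
    (hEt : E ⊆ extCube wd t) {g u : Euc n → Matrix (Fin n) (Fin n) ℝ}
    (hgi : IntegrableOn (fun x => matNorm (g x)) Ω)
    (hgq : IntegrableOn (fun x => matNorm (g x) ^ q * distBd Ω x ^ (-(q * β))) Ω)
    (hum : AEStronglyMeasurable u (volume.restrict Ω))
    (hus : Function.support u ⊆ extCube wd t) {M : ℝ} (hM : 0 ≤ M)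
    (hbd : ∀ x, matNorm (u x) ≤ E.indicator (fun x => matNorm (g x)) x + M) :
    IntegrableOn (fun x => matNorm (u x)) Ω ∧
    IntegrableOn (fun x => matNorm (u x) ^ q * distBd Ω x ^ (-(q * β))) Ω ∧
    ∫ x in extCube wd t, matNorm (u x) ^ q * distBd Ω x ^ (-(q * β)) ≤
      2 ^ q * ((∫ x in E, matNorm (g x) ^ q * distBd Ω x ^ (-(q * β))) +
        M ^ q * (wd.s t / 2) ^ (-(q * β)) * (9 / 8 * wd.s t) ^ n) := by
  have hs := wd.s_pos t
  have hq0 : 0 < q := by linarith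
  have hqβ : 0 ≤ q * β := by positivity
  have htm : MeasurableSet (extCube wd t) := measurableSet_openCube _ _
  have htΩ := extCube_subset_domain hn hΩo wd t
  have hs' : 0 ≤ 9 / 8 * wd.s t := by positivity
  have htv : volume (extCube wd t) ≠ ⊤ := (volume_openCube_lt_top _ hs').ne
  have hmN : AEStronglyMeasurable (fun x => matNorm (u x)) (volume.restrict Ω) :=
    continuous_matNorm.comp_aestronglyMeasurable hum
  have hconst : ∀ c : ℝ, IntegrableOn ((extCube wd t).indicator fun _ => c) Ω := fun c =>
    ((integrable_indicator_iff htm).2 (integrableOn_const htv)).integrableOn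
  set w : Euc n → ℝ := fun x => matNorm (g x) ^ q * distBd Ω x ^ (-(q * β)) with hw
  set m := M ^ q * (wd.s t / 2) ^ (-(q * β)) with hm
  have hm0 : 0 ≤ m := by positivity
  have hdom : IntegrableOn (fun x => 2 ^ q * (E.indicator w x +
      (extCube wd t).indicator (fun _ => m) x)) Ω :=
    ((hgq.indicator hE).add (hconst m)).const_mul _
  have hpt : ∀ x, matNorm (u x) ^ q * distBd Ω x ^ (-(q * β)) ≤
      2 ^ q * (E.indicator w x + (extCube wd t).indicator (fun _ => m) x) := by
    intro x
    by_cases hx : x ∈ extCube wd t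
    · have hρ := distBd_ge_of_mem_extCube hn wd hx
      have h1 : distBd Ω x ^ (-(q * β)) ≤ (wd.s t / 2) ^ (-(q * β)) :=
        Real.rpow_le_rpow_of_nonpos (by linarith) hρ (by linarith)
      have hi : 0 ≤ E.indicator (fun x => matNorm (g x)) x :=
        indicator_nonneg (fun x _ => matNorm_nonneg _) x
      have h2 := (Real.rpow_le_rpow (matNorm_nonneg _) (hbd x) hq0.le).trans
        (add_rpow_le_two_rpow_mul hi hM hq0.le)
      have h3 : E.indicator w x =
          E.indicator (fun x => matNorm (g x)) x ^ q * distBd Ω x ^ (-(q * β)) := by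
        by_cases hxE : x ∈ E
        · simp only [indicator_of_mem hxE, hw]
        · simp only [indicator_of_notMem hxE, Real.zero_rpow hq0.ne', zero_mul]
      rw [indicator_of_mem hx, h3, hm]
      refine (mul_le_mul_of_nonneg_right h2 (distBd_rpow_nonneg x _)).trans ?_
      rw [mul_assoc, add_mul]
      gcongr
    · have hu : u x = 0 := by
        by_contra h
        exact hx (hus h)
      rw [hu, matNorm_zero, Real.zero_rpow hq0.ne', zero_mul]
      exact mul_nonneg (by positivity) (add_nonneg (indicator_nonneg (fun x _ => mul_nonneg
        (Real.rpow_nonneg (matNorm_nonneg _) _) (distBd_rpow_nonneg x _)) x)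
        (indicator_nonneg (fun _ _ => hm0) x))
  have hint : IntegrableOn (fun x => matNorm (u x) ^ q * distBd Ω x ^ (-(q * β))) Ω := by
    refine Integrable.mono' hdom ((hmN.aemeasurable.pow_const q).mul
      (measurable_distBd_rpow _).aemeasurable).aestronglyMeasurable
      (Filter.Eventually.of_forall fun x => ?_)
    rw [Real.norm_of_nonneg (mul_nonneg (Real.rpow_nonneg (matNorm_nonneg _) _)
      (distBd_rpow_nonneg x _))]
    exact hpt x
  refine ⟨?_, hint, ?_⟩
  · refine Integrable.mono' ((hgi.indicator hE).add (hconst M)) hmN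
      (Filter.Eventually.of_forall fun x => ?_)
    rw [Real.norm_of_nonneg (matNorm_nonneg _), Pi.add_apply]
    by_cases hx : x ∈ extCube wd t
    · rw [indicator_of_mem hx]
      exact hbd x
    · have hu : u x = 0 := by
        by_contra h
        exact hx (hus h)
      rw [hu, matNorm_zero, indicator_of_notMem hx, add_zero]
      exact indicator_nonneg (fun x _ => matNorm_nonneg _) x
  · refine (setIntegral_mono (hint.mono_set htΩ) (hdom.mono_set htΩ) hpt).trans (le_of_eq ?_)
    rw [integral_const_mul, integral_add ((hgq.indicator hE).mono_set htΩ)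
      ((hconst m).mono_set htΩ), setIntegral_indicator hE, setIntegral_indicator htm,
      inter_eq_right.2 hEt, inter_self, setIntegral_const, smul_eq_mul, measureReal_def, extCube,
      volume_openCube _ hs', ENNReal.toReal_ofReal (pow_nonneg hs' n), mul_comm m]

end WeightedEstimates

section Construction

variable {n : ℕ} {Ω : Set (Euc n)} {Γ : Type}

/-- Fields obtained by moving the moments of `f s` along the path from `s` to the root: the `k`-th
one is carried by the cube of the `k`-th ancestor of `s` and by that of the `(k-1)`-st one. -/
lemma exists_transported_fields (hn : 0 < n) (hΩo : IsOpen Ω) (hΩb : Bornology.IsBounded Ω)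
    (wd : WhitneyDecomp n Ω Γ) (T : IndexTree Γ) {K : ℝ}
    (hadj : ∀ s, s ≠ T.root → (closedCube (wd.c s) (wd.s s) ∩
        closedCube (wd.c (T.parent s)) (wd.s (T.parent s))).Nonempty)
    (hK : ∀ s k, k ≤ T.depth s → wd.s s ≤ K * wd.s (T.parent^[k] s) ∧
        dist (wd.c s) (wd.c (T.parent^[k] s)) ≤ K * wd.s (T.parent^[k] s)) :
    ∃ C : ℝ, 0 < C ∧ ∀ f : Γ → Euc n → Matrix (Fin n) (Fin n) ℝ,
      (∀ s, AEStronglyMeasurable (f s) (volume.restrict Ω)) →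
      (∀ s, IntegrableOn (fun x => matNorm (f s x)) Ω) →
      (∀ s, Function.support (f s) ⊆ closedCube (wd.c s) (wd.s s)) →
      ∃ e : Γ → ℕ → Euc n → Matrix (Fin n) (Fin n) ℝ,
        (∀ s, e s 0 = f s) ∧ (∀ s, e s (T.depth s + 1) = 0) ∧
        (∀ s k, AEStronglyMeasurable (e s k) (volume.restrict Ω)) ∧
        (∀ s k, IntegrableOn (fun x => matNorm (e s k x)) Ω) ∧
        (∀ s k, k ≤ T.depth s → Function.support (e s k) ⊆ extCube wd (T.parent^[k] s)) ∧
        (∀ s k, k ≤ T.depth s → Function.support (e s (k + 1)) ⊆ extCube wd (T.parent^[k] s)) ∧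
        (∀ s k, k ≤ T.depth s → ∀ η ∈ Vset n,
          ∫ x in Ω, matDot (e s k x) (η x) = ∫ x in Ω, matDot (f s x) (η x)) ∧
        ∀ s k, k ≤ T.depth s → ∀ z, matNorm (e s k z - e s (k + 1) z) ≤
          (if k = 0 then matNorm (f s z) else 0) +
            C * (wd.s (T.parent^[k] s) ^ n)⁻¹ * ∫ x in Ω, matNorm (f s x) := by
  have hn' := one_le_sqrt_natCast hn
  choose! y hy using hadj
  obtain ⟨C, hC, hloc⟩ := exists_localized_field n (32 * (√n + K + √n * K))
  set C₁ := C * 32 ^ n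
  have hC₁ : 0 < C₁ := by positivity
  refine ⟨C₁ * 4 ^ n + C₁, by positivity, fun f hfm hfi hfs => ?_⟩
  have hI : ∀ s, 0 ≤ ∫ x in Ω, matNorm (f s x) := fun s => integral_nonneg fun x => matNorm_nonneg _
  have hstep : ∀ s k, k < T.depth s → ∃ P : Euc n → Matrix (Fin n) (Fin n) ℝ,
      Function.support P ⊆ extCube wd (T.parent^[k] s) ∩ extCube wd (T.parent^[k + 1] s) ∧
      AEStronglyMeasurable P (volume.restrict Ω) ∧
      (∀ z, matNorm (P z) ≤ C₁ * (wd.s (T.parent^[k] s) ^ n)⁻¹ * ∫ x in Ω, matNorm (f s x)) ∧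
      wd.s (T.parent^[k + 1] s) ≤ 4 * wd.s (T.parent^[k] s) ∧
      ∀ η ∈ Vset n, ∫ x in Ω, matDot (P x) (η x) = ∫ x in Ω, matDot (f s x) (η x) := by
    intro s k hk
    obtain ⟨hKs, hKd⟩ := hK s k hk.le
    have hpar : T.parent^[k + 1] s = T.parent (T.parent^[k] s) := Function.iterate_succ_apply' _ _ _
    have hyu := hy _ (T.iterate_ne_root hk)
    rw [← hpar] at hyu
    set u := T.parent^[k] s
    set v := T.parent^[k + 1] s
    have hu := wd.s_pos u
    have huv : wd.s u ≤ 4 * wd.s v := side_le_of_inter hn wd ⟨_, hyu⟩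
    have hvu : wd.s v ≤ 4 * wd.s u := side_le_of_inter hn wd ⟨_, hyu.2, hyu.1⟩
    have hsub : openCube (y u) (wd.s u / 32) ⊆ extCube wd u :=
      openCube_subset_extCube wd hyu.1 (by linarith)
    have hsub' : openCube (y u) (wd.s u / 32) ⊆ extCube wd v :=
      openCube_subset_extCube wd hyu.2 (by linarith)
    obtain ⟨P, hPs, hPm, hPb, hPη⟩ := hloc Ω hΩo hΩb (y u) (wd.s u / 32) (by positivity)
      (hsub.trans (extCube_subset_domain hn hΩo wd u)) (f s) (hfm s) (hfi s) fun x hx => by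
        have h1 := dist_center_le_of_mem_extCube wd (closedCube_subset_extCube wd s (hfs s hx))
        have h2 := dist_center_le_of_mem_extCube wd (closedCube_subset_extCube wd u hyu.1)
        have h3 := dist_triangle4 x (wd.c s) (wd.c u) (y u)
        rw [dist_comm (wd.c u)] at h3
        have h4 := mul_le_mul_of_nonneg_left hKs (by linarith : 0 ≤ √(n : ℝ))
        rw [mem_closedBall]
        linarith
    refine ⟨P, fun x hx => ⟨hsub (hPs hx), hsub' (hPs hx)⟩, hPm, fun z => (hPb z).trans
      (le_of_eq ?_), hvu, hPη⟩
    rw [div_pow, inv_div]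
    simp only [C₁]
    ring
  choose! P hPs hPm hPb hPv hPη using hstep
  obtain ⟨e, he0, heS, heZ⟩ : ∃ e : Γ → ℕ → Euc n → Matrix (Fin n) (Fin n) ℝ,
      (∀ s, e s 0 = f s) ∧ (∀ s k, k < T.depth s → e s (k + 1) = P s k) ∧
      ∀ s k, ¬ k < T.depth s → e s (k + 1) = 0 :=
    ⟨fun s k => Nat.casesOn k (f s) fun j => if j < T.depth s then P s j else 0, fun s => rfl,
      fun s k hk => if_pos hk, fun s k hk => if_neg hk⟩
  have hem : ∀ s k, AEStronglyMeasurable (e s k) (volume.restrict Ω) := by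
    rintro s (_ | k)
    · rw [he0]; exact hfm s
    · by_cases hk : k < T.depth s
      · rw [heS s k hk]; exact hPm s k hk
      · rw [heZ s k hk]; exact aestronglyMeasurable_const
  have heb : ∀ s k, k ≤ T.depth s → ∀ z, matNorm (e s (k + 1) z) ≤
      C₁ * (wd.s (T.parent^[k] s) ^ n)⁻¹ * ∫ x in Ω, matNorm (f s x) := by
    intro s k _ z
    by_cases hk : k < T.depth s
    · rw [heS s k hk]; exact hPb s k hk z
    · rw [heZ s k hk, Pi.zero_apply, matNorm_zero]
      have := wd.s_pos (T.parent^[k] s)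
      have := hI s
      positivity
  refine ⟨e, he0, fun s => heZ s _ (lt_irrefl _), hem, ?_, ?_, ?_, ?_, ?_⟩
  · rintro s (_ | k)
    · rw [he0]; exact hfi s
    · by_cases hk : k < T.depth s
      · refine Integrable.mono' (integrableOn_const (C := C₁ *
          (wd.s (T.parent^[k] s) ^ n)⁻¹ * ∫ x in Ω, matNorm (f s x)) hΩb.measure_lt_top.ne)
          (continuous_matNorm.comp_aestronglyMeasurable (hem s (k + 1)))
          (Filter.Eventually.of_forall fun z => ?_)
        rw [Real.norm_of_nonneg (matNorm_nonneg _)]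
        exact heb s k hk.le z
      · simp only [heZ s k hk, Pi.zero_apply, matNorm_zero]
        exact integrableOn_zero
  · rintro s (_ | k) hk
    · rw [he0]; exact (hfs s).trans (closedCube_subset_extCube wd s)
    · rw [heS s k hk]; exact (hPs s k hk).trans inter_subset_right
  · intro s k _
    by_cases hk : k < T.depth s
    · rw [heS s k hk]; exact (hPs s k hk).trans inter_subset_left
    · rw [heZ s k hk, Function.support_zero]; exact empty_subset _
  · rintro s (_ | k) hk η hη
    · rw [he0]
    · rw [heS s k hk]; exact hPη s k hk η hη
  · rintro s (_ | k) hk z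
    · have h1 := heb s 0 hk z
      have h2 : 0 ≤ C₁ * 4 ^ n * (wd.s (T.parent^[0] s) ^ n)⁻¹ * ∫ x in Ω, matNorm (f s x) := by
        have := wd.s_pos (T.parent^[0] s)
        have := hI s
        positivity
      rw [if_pos rfl]
      refine (matNorm_sub_le _ _).trans ?_
      rw [he0]
      linarith
    · have h1 := heb s (k + 1) hk z
      have h2 := heb s k (by omega) z
      have h3 : (wd.s (T.parent^[k] s) ^ n)⁻¹ ≤ 4 ^ n * (wd.s (T.parent^[k + 1] s) ^ n)⁻¹ := by
        have ha := wd.s_pos (T.parent^[k] s)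
        have hb := wd.s_pos (T.parent^[k + 1] s)
        rw [← div_eq_mul_inv, inv_le_comm₀ (by positivity) (by positivity), inv_div, ← div_pow]
        exact pow_le_pow_left₀ (by positivity) (by linarith [hPv s k hk]) n
      have h4 := mul_le_mul_of_nonneg_right (mul_le_mul_of_nonneg_left h3 hC₁.le) (hI s)
      rw [if_neg (Nat.succ_ne_zero k)]
      refine (matNorm_sub_le _ _).trans ?_
      linarith

/-- The decomposition of a field with vanishing moments along a tree of Whitney cubes. -/
lemma exists_decomposition (hn : 0 < n) (hΩo : IsOpen Ω) (hΩb : Bornology.IsBounded Ω)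
    (wd : WhitneyDecomp n Ω Γ) (T : IndexTree Γ) {K : ℝ}
    (hadj : ∀ s, s ≠ T.root → (closedCube (wd.c s) (wd.s s) ∩
        closedCube (wd.c (T.parent s)) (wd.s (T.parent s))).Nonempty)
    (hK : ∀ s k, k ≤ T.depth s → wd.s s ≤ K * wd.s (T.parent^[k] s) ∧
        dist (wd.c s) (wd.c (T.parent^[k] s)) ≤ K * wd.s (T.parent^[k] s))
    {E : Γ → Set (Euc n)} (hEm : ∀ t, MeasurableSet (E t))
    (hEd : Pairwise (Function.onFun Disjoint E)) (hEu : (⋃ t, E t) = Ω)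
    (hEt : ∀ t, E t ⊆ closedCube (wd.c t) (wd.s t)) :
    ∃ C : ℝ, 0 < C ∧ ∀ g : Euc n → Matrix (Fin n) (Fin n) ℝ,
      AEStronglyMeasurable g (volume.restrict Ω) → IntegrableOn (fun x => matNorm (g x)) Ω →
      (∀ η ∈ Vset n, ∫ x in Ω, matDot (g x) (η x) = 0) → ∀ G : Finset Γ, T.AncestorClosed G →
      {t : Γ | (Function.support g ∩ extCube wd t).Nonempty} ⊆ G →
      ∃ u : Γ → Euc n → Matrix (Fin n) (Fin n) ℝ,
        (∀ x ∈ Ω, g x = ∑ t ∈ G, u t x) ∧ (∀ t, t ∉ G → u t = 0) ∧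
        (∀ t, Function.support (u t) ⊆ extCube wd t) ∧
        (∀ t, AEStronglyMeasurable (u t) (volume.restrict Ω)) ∧
        (∀ t, ∀ η ∈ Vset n, ∫ x in Ω, matDot (u t x) (η x) = 0) ∧
        ∀ t x, matNorm (u t x) ≤ (E t).indicator (fun x => matNorm (g x)) x +
          C * (wd.s t ^ n)⁻¹ * ∑ y ∈ T.desc G t, ∫ x in E y.1, matNorm (g x) := by
  classical
  obtain ⟨C, hC, htrans⟩ := exists_transported_fields hn hΩo hΩb wd T hadj hK
  refine ⟨C, hC, fun g hgm hgi hgη G hG hFG => ?_⟩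
  have hEΩ : ∀ t, E t ⊆ Ω := fun t => hEu ▸ subset_iUnion E t
  set f : Γ → Euc n → Matrix (Fin n) (Fin n) ℝ := fun s => (E s).indicator g with hf
  have hfN : ∀ s x, matNorm (f s x) = (E s).indicator (fun x => matNorm (g x)) x := fun s x => by
    by_cases hx : x ∈ E s
    · simp only [hf, indicator_of_mem hx]
    · simp only [hf, indicator_of_notMem hx, matNorm_zero]
  have hfI : ∀ s, ∫ x in Ω, matNorm (f s x) = ∫ x in E s, matNorm (g x) := fun s => by
    simp only [hfN]
    rw [setIntegral_indicator (hEm s), inter_eq_right.2 (hEΩ s)]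
  obtain ⟨e, he0, heZ, hem, hei, hes, hes', heη, heb⟩ := htrans f
    (fun s => hgm.indicator (hEm s)) (fun s => by
      simp only [hfN]; exact hgi.indicator (hEm s))
    (fun s => support_indicator_subset.trans (hEt s))
  set u : Γ → Euc n → Matrix (Fin n) (Fin n) ℝ := fun t x =>
    ∑ y ∈ T.desc G t, (e y.1 y.2 x - e y.1 (y.2 + 1) x) with hu
  have hsum : ∀ x ∈ Ω, g x = ∑ t ∈ G, u t x := by
    intro x hx
    rw [T.sum_desc_sum hG (fun y => e y.1 y.2 x - e y.1 (y.2 + 1) x), IndexTree.pairs,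
      Finset.sum_sigma]
    simp only [Finset.sum_range_sub', he0, heZ, Pi.zero_apply, sub_zero]
    rw [← hEu, mem_iUnion] at hx
    obtain ⟨t, ht⟩ := hx
    have hne : ∀ s, s ≠ t → f s x = 0 := fun s hs =>
      indicator_of_notMem (fun h => Set.disjoint_left.1 (hEd hs) h ht) g
    have hft : f t x = g x := indicator_of_mem ht g
    rw [Finset.sum_eq_single t (fun s _ hs => hne s hs) (fun htG => ?_), hft]
    rw [hft]
    by_contra h
    exact htG (hFG ⟨x, h, closedCube_subset_extCube wd t (hEt t ht)⟩)
  have hout : ∀ t, t ∉ G → u t = 0 := by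
    intro t ht
    have : T.desc G t = ∅ := Finset.eq_empty_of_forall_notMem fun y hy => by
      rw [T.mem_desc] at hy
      exact ht (hy.2 ▸ hG _ hy.1.1 _ hy.1.2)
    funext x
    simp only [hu, this, Finset.sum_empty, Pi.zero_apply]
  have hum : ∀ t, AEStronglyMeasurable (u t) (volume.restrict Ω) := fun t =>
    Finset.aestronglyMeasurable_fun_sum _ fun y _ => (hem _ _).sub (hem _ _)
  have hdot : ∀ s k, ∀ η ∈ Vset n, IntegrableOn (fun x => matDot (e s k x) (η x)) Ω :=
    fun s k η hη => integrableOn_matDot hΩb hΩo.measurableSet (hem s k) (hei s k)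
      (continuous_of_mem_Vset hη)
  have humom : ∀ t, ∀ η ∈ Vset n, ∫ x in Ω, matDot (u t x) (η x) = ∑ y ∈ T.desc G t,
      ((∫ x in Ω, matDot (e y.1 y.2 x) (η x)) - ∫ x in Ω, matDot (e y.1 (y.2 + 1) x) (η x)) := by
    intro t η hη
    simp only [hu, matDot_sum_left, matDot_sub_left]
    rw [integral_finsetSum]
    · exact Finset.sum_congr rfl fun y _ => integral_sub (hdot _ _ η hη) (hdot _ _ η hη)
    · exact fun y _ => (hdot _ _ η hη).sub (hdot _ _ η hη)
  have huint : ∀ t, ∀ η ∈ Vset n, IntegrableOn (fun x => matDot (u t x) (η x)) Ω := by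
    intro t η hη
    simp only [hu, matDot_sum_left, matDot_sub_left]
    exact integrable_finsetSum _ fun y _ => (hdot _ _ η hη).sub (hdot _ _ η hη)
  have hmom : ∀ t, t ≠ T.root → ∀ η ∈ Vset n, ∫ x in Ω, matDot (u t x) (η x) = 0 := by
    intro t ht η hη
    rw [humom t η hη]
    refine Finset.sum_eq_zero fun y hy => ?_
    obtain ⟨⟨-, hyd⟩, hyt⟩ := T.mem_desc.1 hy
    have hlt : y.2 < T.depth y.1 := lt_of_le_of_ne hyd fun h => ht (by
      rw [← hyt, h, T.iterate_depth])
    rw [heη _ _ hyd η hη, heη _ _ hlt η hη, sub_self]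
  refine ⟨u, hsum, hout, fun t x hx => ?_, hum, fun t η hη => ?_, fun t x => ?_⟩
  · by_contra hxt
    refine hx (Finset.sum_eq_zero fun y hy => ?_)
    obtain ⟨⟨-, hyd⟩, rfl⟩ := T.mem_desc.1 hy
    rw [Function.notMem_support.1 (fun h => hxt (hes _ _ hyd h)),
      Function.notMem_support.1 (fun h => hxt (hes' _ _ hyd h)), sub_zero]
  · by_cases ht : t = T.root
    · by_cases htG : t ∈ G
      · rw [← Finset.sum_eq_single_of_mem (f := fun t => ∫ x in Ω, matDot (u t x) (η x)) t htG
          fun s _ hs => hmom s (ht ▸ hs) η hη, ← integral_finsetSum _ fun s _ => huint s η hη,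
          ← hgη η hη]
        refine setIntegral_congr_fun hΩo.measurableSet fun x hx => ?_
        simp only [← matDot_sum_left, ← hsum x hx]
      · simp only [hout t htG, Pi.zero_apply, matDot_zero_left, integral_zero]
    · exact hmom t ht η hη
  · refine (matNorm_sum_le _ _).trans ?_
    have h1 : ∀ y ∈ T.desc G t, matNorm (e y.1 y.2 x - e y.1 (y.2 + 1) x) ≤
        (if y = ⟨t, 0⟩ then matNorm (f t x) else 0) +
          C * (wd.s t ^ n)⁻¹ * ∫ x in E y.1, matNorm (g x) := by
      rintro ⟨s, k⟩ hy
      obtain ⟨⟨-, hyd⟩, rfl⟩ := T.mem_desc.1 hy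
      refine (heb s k hyd x).trans ?_
      rw [hfI]
      refine add_le_add_left (le_of_eq ?_) _
      rcases k with _ | k
      · exact (if_pos rfl).trans (if_pos rfl).symm
      · rw [if_neg (Nat.succ_ne_zero k), if_neg]
        intro h
        rw [Sigma.mk.injEq] at h
        exact Nat.succ_ne_zero k (eq_of_heq h.2)
    refine (Finset.sum_le_sum h1).trans ?_
    rw [Finset.sum_add_distrib, ← Finset.mul_sum, Finset.sum_ite_eq', ← hfN]
    refine add_le_add_left ?_ _
    split_ifs
    · exact le_rfl
    · exact matNorm_nonneg _

end Construction

section Summation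

variable {n : ℕ} {Ω : Set (Euc n)} {Γ : Type}

lemma exists_packing_const (hn : 0 < n) (wd : WhitneyDecomp n Ω Γ) (T : IndexTree Γ) {K : ℝ}
    (hK0 : 0 < K)
    (hK : ∀ s k, k ≤ T.depth s → wd.s s ≤ K * wd.s (T.parent^[k] s) ∧
      dist (wd.c s) (wd.c (T.parent^[k] s)) ≤ K * wd.s (T.parent^[k] s)) :
    ∃ C : ℝ, 0 < C ∧ ∀ G t, ∑ x ∈ T.desc G t, wd.s x.1 ^ n ≤ C * wd.s t ^ n := by
  classical
  have hn' := one_le_sqrt_natCast hn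
  set R := √n * K + K with hR
  have hR0 : 0 < R := by positivity
  refine ⟨(2 * R + 2) ^ n, by positivity, fun G t => ?_⟩
  have hs := wd.s_pos t
  have hh : 0 ≤ (2 * R + 2) * wd.s t := by positivity
  rw [← Finset.sum_image (f := fun s => wd.s s ^ n) (T.desc_fst_injOn G t), ← mul_pow]
  have h := sum_side_pow_le wd ((T.desc G t).image fun x => x.1)
    (volume_openCube_lt_top (wd.c t) hh).ne fun s hst x hx i => ?_
  · rwa [volume_openCube _ hh, ENNReal.toReal_ofReal (by positivity)] at h
  obtain ⟨⟨s, k⟩, hy, rfl⟩ := Finset.mem_image.1 hst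
  obtain ⟨⟨-, hk⟩, rfl⟩ := T.mem_desc.1 hy
  obtain ⟨h1, h2⟩ := hK s k hk
  have h3 := dist_center_le_of_mem_extCube wd
    (closedCube_subset_extCube wd s (openCube_subset_closedCube _ _ hx))
  have h4 : dist x (wd.c (T.parent^[k] s)) ≤ R * wd.s (T.parent^[k] s) := by
    refine (dist_triangle _ _ _).trans ((add_le_add h3 h2).trans ?_)
    rw [hR, add_mul, mul_assoc]
    gcongr
  have h5 : |x i - wd.c (T.parent^[k] s) i| ≤ dist x (wd.c (T.parent^[k] s)) := by
    rw [dist_eq_norm]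
    exact PiLp.norm_apply_le (x - wd.c (T.parent^[k] s)) i
  simp only at hs ⊢
  linarith

lemma sum_setIntegral_le {G : Finset Γ} {E : Γ → Set (Euc n)}
    (hEm : ∀ t, MeasurableSet (E t)) (hEd : Pairwise (Function.onFun Disjoint E))
    (hEΩ : ∀ t, E t ⊆ Ω) {w : Euc n → ℝ} (hw0 : ∀ x, 0 ≤ w x) (hw : IntegrableOn w Ω) :
    ∑ t ∈ G, ∫ x in E t, w x ≤ ∫ x in Ω, w x := by
  rw [← integral_biUnion_finset G (fun t _ => hEm t) (fun s _ t _ h => hEd h)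
    fun t _ => hw.mono_set (hEΩ t)]
  exact setIntegral_mono_set hw (Filter.Eventually.of_forall hw0)
    (Filter.Eventually.of_forall (iUnion₂_subset fun t _ => hEΩ t))

lemma exists_sum_rpow_avg_le (hn : 0 < n) (wd : WhitneyDecomp n Ω Γ) (T : IndexTree Γ) {K : ℝ}
    (hK0 : 0 < K)
    (hK : ∀ s k, k ≤ T.depth s → wd.s s ≤ K * wd.s (T.parent^[k] s) ∧
      dist (wd.c s) (wd.c (T.parent^[k] s)) ≤ K * wd.s (T.parent^[k] s))
    {q β : ℝ} (hq : 1 < q) (hβ : 0 ≤ β) {C : ℝ} (hC : 0 < C) :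
    ∃ D : ℝ, 0 < D ∧ ∀ G : Finset Γ, T.AncestorClosed G → ∀ a J : Γ → ℝ, (∀ s, 0 ≤ a s) →
      (∀ s, a s ^ q ≤ (wd.s s ^ n) ^ (q - 1) * (6 * √n * wd.s s) ^ (q * β) * J s) →
      ∑ t ∈ G, (C * (wd.s t ^ n)⁻¹ * ∑ y ∈ T.desc G t, a y.1) ^ q *
        (wd.s t / 2) ^ (-(q * β)) * (9 / 8 * wd.s t) ^ n ≤ D * ∑ s ∈ G, J s := by
  obtain ⟨Cp, hCp, hpack⟩ := exists_packing_const hn wd T hK0 hK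
  obtain ⟨B, hB, hardy⟩ := T.hardy_inequality hCp hq
  have hn' := one_le_sqrt_natCast hn
  have hq0 : 0 < q := by linarith
  set A := (C * K ^ β) ^ q * 2 ^ (q * β) * (9 / 8) ^ n with hA
  have hA0 : 0 < A := by positivity
  refine ⟨A * (B * (6 * √n) ^ (q * β)), by positivity, fun G hG a J ha haJ => ?_⟩
  have hs := wd.s_pos
  set v : Γ → ℝ := fun s => wd.s s ^ n with hv
  have hv0 : ∀ s, 0 < v s := fun s => pow_pos (hs s) n
  set b : Γ → ℝ := fun s => a s * (v s)⁻¹ * (wd.s s ^ β)⁻¹ with hb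
  have hb0 : ∀ s, 0 ≤ b s := fun s => by
    have := ha s; have := hv0 s; have := hs s
    positivity
  have hvb : ∀ s, v s * b s * wd.s s ^ β = a s := fun s => by
    have := (hv0 s).ne'; have := (Real.rpow_pos_of_pos (hs s) β).ne'
    simp only [hb]; field_simp
  have hS0 : ∀ t, 0 ≤ ∑ y ∈ T.desc G t, v y.1 * b y.1 := fun t =>
    Finset.sum_nonneg fun y _ => mul_nonneg (hv0 _).le (hb0 _)
  have hterm : ∀ t ∈ G, (C * (wd.s t ^ n)⁻¹ * ∑ y ∈ T.desc G t, a y.1) ^ q *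
      (wd.s t / 2) ^ (-(q * β)) * (9 / 8 * wd.s t) ^ n ≤
      A * (v t ^ (1 - q) * (∑ y ∈ T.desc G t, v y.1 * b y.1) ^ q) := by
    intro t _
    have hst := hs t
    have hvt := hv0 t
    have h1 : ∑ y ∈ T.desc G t, a y.1 ≤
        K ^ β * wd.s t ^ β * ∑ y ∈ T.desc G t, v y.1 * b y.1 := by
      rw [Finset.mul_sum]
      refine Finset.sum_le_sum fun y hy => ?_
      obtain ⟨⟨-, hk⟩, rfl⟩ := T.mem_desc.1 hy
      rw [← hvb y.1, mul_comm (K ^ β * _), ← Real.mul_rpow hK0.le (hs _).le]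
      exact mul_le_mul_of_nonneg_left (Real.rpow_le_rpow (hs _).le (hK _ _ hk).1 hβ)
        (mul_nonneg (hv0 _).le (hb0 _))
    have h0 : 0 ≤ ∑ y ∈ T.desc G t, a y.1 := Finset.sum_nonneg fun y _ => ha _
    have h2 : (C * (wd.s t ^ n)⁻¹ * ∑ y ∈ T.desc G t, a y.1) ^ q ≤
        (C * K ^ β * wd.s t ^ β * (v t)⁻¹ * ∑ y ∈ T.desc G t, v y.1 * b y.1) ^ q := by
      refine Real.rpow_le_rpow (by positivity) ?_ hq0.le
      refine (mul_le_mul_of_nonneg_left h1 (by positivity)).trans (le_of_eq ?_)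
      simp only [hv]; ring
    refine (mul_le_mul_of_nonneg_right (mul_le_mul_of_nonneg_right h2
      (by positivity)) (by positivity)).trans (le_of_eq ?_)
    have hS := hS0 t
    rw [Real.mul_rpow (by positivity) hS, Real.mul_rpow (by positivity) (by positivity),
      Real.mul_rpow (by positivity) (by positivity), Real.div_rpow hst.le two_pos.le,
      ← Real.rpow_mul hst.le, Real.rpow_neg hst.le, Real.rpow_neg two_pos.le,
      Real.rpow_sub hvt, Real.rpow_one, Real.inv_rpow hvt.le, mul_pow, mul_comm β q, hA]
    have := (Real.rpow_pos_of_pos hst (q * β)).ne'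
    have := (Real.rpow_pos_of_pos hvt q).ne'
    simp only [hv]
    field_simp
  have hbJ : ∀ s ∈ G, v s * b s ^ q ≤ (6 * √n) ^ (q * β) * J s := by
    intro s _
    have hss := hs s
    have hvs := hv0 s
    have h1 : v s * b s ^ q = a s ^ q * (v s ^ (q - 1))⁻¹ * (wd.s s ^ (q * β))⁻¹ := by
      simp only [hb]
      rw [Real.mul_rpow (mul_nonneg (ha s) (by positivity)) (by positivity),
        Real.mul_rpow (ha s) (by positivity), Real.inv_rpow hvs.le, Real.inv_rpow (by positivity),
        ← Real.rpow_mul hss.le, Real.rpow_sub hvs, Real.rpow_one, mul_comm β q]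
      have := (Real.rpow_pos_of_pos hvs q).ne'
      field_simp
    rw [h1]
    refine (mul_le_mul_of_nonneg_right (mul_le_mul_of_nonneg_right (haJ s)
      (by positivity)) (by positivity)).trans (le_of_eq ?_)
    rw [Real.mul_rpow (by positivity) hss.le]
    have := (Real.rpow_pos_of_pos hss (q * β)).ne'
    have := (Real.rpow_pos_of_pos hvs (q - 1)).ne'
    simp only [hv] at this ⊢
    field_simp
  refine (Finset.sum_le_sum hterm).trans ?_
  rw [← Finset.mul_sum, mul_assoc A]
  refine mul_le_mul_of_nonneg_left ?_ hA0.le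
  refine (hardy G hG v b hv0 hb0 fun t => hpack G t).trans ?_
  rw [mul_assoc]
  refine mul_le_mul_of_nonneg_left ?_ hB.le
  rw [Finset.mul_sum]
  exact Finset.sum_le_sum hbJ

end Summation

/-- the `V`-decomposition of functions in `W₀` subordinate to the extended
Whitney cubes, with the estimate `Σ_t ‖g_t‖_{L^q(Ω_t,ρ^{−β})}^q ≤ C₀^q ‖g‖_{L^q(Ω,ρ^{−β})}^q`. -/
theorem V_decomposition_of_W0
    {n : ℕ} (hn : 3 ≤ n) (Ω : Set (Euc n)) (hΩo : IsOpen Ω) (hΩc : IsConnected Ω)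
    (hΩb : Bornology.IsBounded Ω) (hJ : IsJohnDomain Ω)
    (p q β : ℝ) (hp1 : 1 < p) (hq1 : 1 < q) (hpq : 1 / p + 1 / q = 1) (hβ : 0 ≤ β)
    (Γ : Type) (wd : WhitneyDecomp n Ω Γ) :
    ∃ C₀ : ℝ, 0 < C₀ ∧ ∀ g : Euc n → Matrix (Fin n) (Fin n) ℝ,
      memW0 q β wd g →
      ∃ gt : Γ → Euc n → Matrix (Fin n) (Fin n) ℝ,
        (∀ x ∈ Ω, g x = ∑ᶠ t, gt t x) ∧
        (∀ t, Function.support (gt t) ⊆ extCube wd t) ∧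
        (∀ t, memW0 q β wd (gt t)) ∧
        (∑ᶠ t, ∫ x in extCube wd t, matNorm (gt t x) ^ q * distBd Ω x ^ (-(q * β)))
          ≤ C₀ ^ q * ∫ x in Ω, matNorm (g x) ^ q * distBd Ω x ^ (-(q * β)) ∧
        {t : Γ | gt t ≠ 0}.Finite := by
  have hn0 : 0 < n := by omega
  have hq0 : 0 < q := by linarith
  obtain ⟨T, K, hK0, hadj, hK⟩ := exists_johnTree hn0 hΩb hJ wd
  obtain ⟨E, hEm, hEd, hEu, hEt⟩ := exists_measurable_partition wd
  have hEΩ : ∀ t, E t ⊆ Ω := fun t => hEu ▸ subset_iUnion E t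
  obtain ⟨C, hC, hdec⟩ := exists_decomposition hn0 hΩo hΩb wd T hadj hK hEm hEd hEu hEt
  obtain ⟨D, hD, hsum⟩ := exists_sum_rpow_avg_le hn0 wd T hK0 hK hq1 hβ hC
  refine ⟨(2 ^ q * (1 + D)) ^ (1 / q), by positivity, fun g hg => ?_⟩
  obtain ⟨⟨hgm, hgi, hgq, hgη⟩, hgF⟩ := hg
  obtain ⟨G, hG, hFG⟩ := T.exists_ancestorClosed _ hgF
  obtain ⟨u, hgu, hu0, hus, hum, huη, hubd⟩ := hdec g hgm hgi hgη G hG hFG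
  have ha0 : ∀ s, 0 ≤ ∫ x in E s, matNorm (g x) := fun s =>
    integral_nonneg fun x => matNorm_nonneg _
  have hest := fun t => integral_extCube_le hn0 hΩo wd hq1 hβ (hEm t)
    ((hEt t).trans (closedCube_subset_extCube wd t)) hgi hgq (hum t) (hus t)
    (mul_nonneg (mul_nonneg hC.le (inv_nonneg.2 (pow_nonneg (wd.s_pos t).le n)))
      (Finset.sum_nonneg fun (y : Σ _ : Γ, ℕ) (_ : y ∈ T.desc G t) => ha0 y.1)) (hubd t)
  refine ⟨u, fun x hx => ?_, hus, fun t => ⟨⟨hum t, (hest t).1, (hest t).2.1, huη t⟩, ?_⟩, ?_, ?_⟩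
  · rw [hgu x hx, finsum_eq_sum_of_support_subset]
    intro t ht
    by_contra h
    exact ht (congrFun (hu0 t h) x)
  · exact (finite_inter_extCube hn0 wd hΩb t).subset fun t' ht' =>
      ht'.mono (inter_subset_inter_left _ (hus t))
  · rw [finsum_eq_sum_of_support_subset (s := G), ← Real.rpow_mul (by positivity),
      one_div_mul_cancel hq0.ne', Real.rpow_one]
    · refine (Finset.sum_le_sum fun t _ => (hest t).2.2).trans ?_
      rw [← Finset.mul_sum, Finset.sum_add_distrib, mul_assoc]
      refine mul_le_mul_of_nonneg_left ?_ (by positivity)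
      have h1 := sum_setIntegral_le (G := G) hEm hEd hEΩ (fun x => mul_nonneg
        (Real.rpow_nonneg (matNorm_nonneg (g x)) q) (distBd_rpow_nonneg x (-(q * β)))) hgq
      have h2 := hsum G hG (fun s => ∫ x in E s, matNorm (g x)) _ ha0 fun s =>
        rpow_integral_matNorm_le hn0 wd hq1 hβ (hEm s) (hEt s) hgm hgq
      have h3 := mul_le_mul_of_nonneg_left h1 hD.le
      linarith
    · intro t ht
      by_contra h
      refine ht ?_
      simp only [hu0 t h, Pi.zero_apply, matNorm_zero, Real.zero_rpow hq0.ne', zero_mul,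
        integral_zero]
  · exact G.finite_toSet.subset fun t ht => by
      by_contra h
      exact ht (hu0 t h)

end
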